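/- Suppose d < δ and δ − d is even. Then there exist subsets S_i ⊆ {1,…,a_{d+i}} with |S_i| = a_i for i = 1,…,i* such that in(I,g) is generated by: the monomials of in(I); the largest monomial of B_d; the monomials of B_{d+i}^{S_i} for i = 1,…,i*; the monomials of z^{2k}·B_{d+i*−k} for k = 1,…,i*; and the monomials of z^{δ−d+2j}·B_{d−j} for j = 1,…,d (where B_0 = {1}). -/

import Mathlib

open MvPolynomial

/-- The total degree of an exponent vector. -/
def expDeg {n : ℕ} (μ : Fin n →₀ ℕ) : ℕ := μ.sum fun _ e => e

/-- Strict degree reverse lexicographic order on exponent vectors, for variables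
`x_1 > ⋯ > x_n` (indexed by `Fin n` in this order). -/
def DrlLT {n : ℕ} (a b : Fin n →₀ ℕ) : Prop :=
  expDeg a < expDeg b ∨
    (expDeg a = expDeg b ∧ ∃ i : Fin n, b i < a i ∧ ∀ j : Fin n, i < j → a j = b j)

/-- `μ` is the leading (degrevlex-largest) exponent of `p`. -/
def IsLeadExp {n : ℕ} {K : Type*} [CommSemiring K] (p : MvPolynomial (Fin n) K)
    (μ : Fin n →₀ ℕ) : Prop :=
  μ ∈ p.support ∧ ∀ ν ∈ p.support, ν ≠ μ → DrlLT ν μ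

/-- The initial ideal of `I` with respect to the degree reverse lexicographic order. -/
noncomputable def initialIdeal {n : ℕ} {K : Type*} [CommRing K]
    (I : Ideal (MvPolynomial (Fin n) K)) : Ideal (MvPolynomial (Fin n) K) :=
  Ideal.span { m | ∃ p ∈ I, p ≠ 0 ∧ ∃ μ, IsLeadExp p μ ∧ m = monomial μ (1 : K) }

/-- The standard monomials of degree `i` of `I` : exponents of the monomials of degree `i`
not lying in the initial ideal of `I`. -/
def stdMon {n : ℕ} {K : Type*} [CommRing K] (I : Ideal (MvPolynomial (Fin n) K)) (i : ℕ) :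
    Set (Fin n →₀ ℕ) :=
  { μ | expDeg μ = i ∧ monomial μ (1 : K) ∉ initialIdeal I }

/-- `μ` is a minimal monomial generator of the monomial ideal `M`. -/
def IsMinGen {n : ℕ} {K : Type*} [CommRing K] (M : Ideal (MvPolynomial (Fin n) K))
    (μ : Fin n →₀ ℕ) : Prop :=
  monomial μ (1 : K) ∈ M ∧ ∀ ν : Fin n →₀ ℕ, ν ≤ μ → ν ≠ μ → monomial ν (1 : K) ∉ M

/-- `μ` satisfies property `P` with respect to the monomial ideal `M`: if `m` is the largest
index of a variable dividing `x^μ`, then every monomial of the same degree in the variables of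
index `< m` also lies in `M`. -/
def SatisfiesP {n : ℕ} {K : Type*} [CommRing K] (M : Ideal (MvPolynomial (Fin n) K))
    (μ : Fin n →₀ ℕ) : Prop :=
  ∀ m : Fin n, μ m ≠ 0 → (∀ j : Fin n, m < j → μ j = 0) →
    ∀ ν : Fin n →₀ ℕ, expDeg ν = expDeg μ → (∀ j : Fin n, m ≤ j → ν j = 0) →
      monomial ν (1 : K) ∈ M

/-- Conjecture E (Pardue) holds for the ideal `I`: every minimal generator of the initial
ideal of `I` satisfies property `P`. -/
def ConjE {n : ℕ} {K : Type*} [CommRing K] (I : Ideal (MvPolynomial (Fin n) K)) : Prop :=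
  ∀ μ, IsMinGen (initialIdeal I) μ → SatisfiesP (initialIdeal I) μ

/-- `f` is a generic sequence of forms of degrees `d i` over the base field `F`: each `f i` is
homogeneous of degree `d i` and the family of all coefficients (at all monomials of degree
`d i`) is algebraically independent over `F`. -/
def IsGenericSeq (F : Type*) {K : Type*} [CommRing F] [CommRing K] [Algebra F K]
    {n r : ℕ} (d : Fin r → ℕ) (f : Fin r → MvPolynomial (Fin n) K) : Prop :=
  (∀ i, (f i).IsHomogeneous (d i)) ∧
    AlgebraicIndependent F
      (fun p : Σ i : Fin r, { μ : Fin n →₀ ℕ // expDeg μ = d i } => (f p.1).coeff p.2.1)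

/-- The projection `K[x_1,…,x_n,z] → K[x_1,…,x_n]` sending `z` (the last variable) to `0` and
fixing the other variables. -/
noncomputable def projMap (K : Type*) [CommRing K] (n : ℕ) :
    MvPolynomial (Fin (n + 1)) K →ₐ[K] MvPolynomial (Fin n) K :=
  aeval (fun i => Fin.lastCases 0 (fun j => X j) i)

/-- Embedding of exponent vectors of `K[x_1,…,x_n]` into those of `K[x_1,…,x_n,z]`
(`z`-exponent `0`). -/
noncomputable def embExp {n : ℕ} (μ : Fin n →₀ ℕ) : Fin (n + 1) →₀ ℕ :=
  Finsupp.embDomain ⟨Fin.castSucc, Fin.castSucc_injective n⟩ μ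

/-- Multiplication by `z^c` on exponent vectors in `K[x_1,…,x_n,z]`. -/
noncomputable def zShift {n : ℕ} (c : ℕ) (μ : Fin (n + 1) →₀ ℕ) : Fin (n + 1) →₀ ℕ :=
  μ + Finsupp.single (Fin.last n) c

/-- `f` (homogeneous of degree `e`) is semi-regular on `R/I`: in each degree `t`, the
multiplication map `(R/I)_t → (R/I)_{t+e}` is injective or surjective. -/
def SemiRegularOn {vars K : Type*} [CommRing K] (I : Ideal (MvPolynomial vars K))
    (f : MvPolynomial vars K) (e : ℕ) : Prop :=
  ∀ t : ℕ,
    (∀ p ∈ homogeneousSubmodule vars K t, f * p ∈ I → p ∈ I) ∨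
    (∀ q ∈ homogeneousSubmodule vars K (t + e),
      ∃ p ∈ homogeneousSubmodule vars K t, q - f * p ∈ I)

/-- The degree-`t` graded piece of `R/I`, as a `K`-submodule of the quotient. -/
noncomputable def quotDegPart {vars K : Type*} [CommRing K] (I : Ideal (MvPolynomial vars K))
    (t : ℕ) : Submodule K (MvPolynomial vars K ⧸ I) :=
  (homogeneousSubmodule vars K t).map (Ideal.Quotient.mkₐ K I).toLinearMap

/-! ### Linear algebra -/

lemma finrank_sup_map_add {K X Y : Type*} [Field K] [AddCommGroup X] [Module K X]
    [AddCommGroup Y] [Module K Y] (φ : X →ₗ[K] Y) (V : Submodule K X) (B : Submodule K Y)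
    [FiniteDimensional K V] [FiniteDimensional K B] :
    Module.finrank K ↥(B ⊔ V.map φ) + Module.finrank K ↥(V ⊓ B.comap φ) =
        Module.finrank K B + Module.finrank K V := by
  have hC : FiniteDimensional K ↥(V ⊓ B.comap φ) :=
    Submodule.finiteDimensional_of_le inf_le_left
  have h1 := Submodule.finrank_sup_add_finrank_inf_eq B (V.map φ)
  have hker : ∀ W : Submodule K X, FiniteDimensional K W →
      Module.finrank K ↥(W.map φ) + Module.finrank K ↥(LinearMap.ker φ ⊓ W) =
        Module.finrank K W := by
    intro W _
    have := LinearMap.finrank_range_add_finrank_ker (φ.domRestrict W)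
    rw [LinearMap.range_domRestrict, LinearMap.ker_domRestrict] at this
    rw [← this, inf_comm]
    congr 1
    rw [← Submodule.map_comap_subtype]
    exact (LinearEquiv.finrank_eq (Submodule.equivMapOfInjective _
      (Submodule.injective_subtype W) _)).symm
  have h2 := hker V inferInstance
  have h3 := hker (V ⊓ B.comap φ) hC
  have h4 : (V ⊓ B.comap φ).map φ = B ⊓ V.map φ := by
    ext y
    constructor
    · rintro ⟨x, ⟨h, h'⟩, rfl⟩
      exact ⟨h', x, h, rfl⟩
    · rintro ⟨h, x, h', rfl⟩
      exact ⟨x, ⟨h', h⟩, rfl⟩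
  have h5 : LinearMap.ker φ ⊓ (V ⊓ B.comap φ) = LinearMap.ker φ ⊓ V := by
    refine le_antisymm (inf_le_inf_left _ inf_le_left) ?_
    intro x hx
    refine ⟨hx.1, hx.2, ?_⟩
    have : φ x = 0 := hx.1
    simp [this]
  rw [h4, h5] at h3
  omega

lemma finrank_sup_map_add_le {K X Y : Type*} [Field K] [AddCommGroup X] [Module K X]
    [AddCommGroup Y] [Module K Y] (φ : X →ₗ[K] Y) {V A : Submodule K X} {B : Submodule K Y}
    [FiniteDimensional K V] [FiniteDimensional K B] (hAV : A ≤ V) (hA : ∀ a ∈ A, φ a ∈ B) :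
    Module.finrank K ↥(B ⊔ V.map φ) + Module.finrank K A ≤
        Module.finrank K B + Module.finrank K V ∧
      (Module.finrank K B + Module.finrank K V ≤
        Module.finrank K ↥(B ⊔ V.map φ) + Module.finrank K A → ∀ v ∈ V, φ v ∈ B → v ∈ A) := by
  have hC : FiniteDimensional K ↥(V ⊓ B.comap φ) :=
    Submodule.finiteDimensional_of_le inf_le_left
  have hAC : A ≤ V ⊓ B.comap φ := le_inf hAV hA
  have h1 := finrank_sup_map_add φ V B
  have h6 := Submodule.finrank_mono hAC
  refine ⟨by omega, fun h v hv hvB => ?_⟩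
  have := Submodule.eq_of_le_of_finrank_eq hAC (by omega)
  rw [this]
  exact ⟨hv, hvB⟩

/-- Spanning the full space is an open condition: if it holds after some specialization, it
holds for the generic values of the parameters. -/
lemma span_range_eq_top_of_specialization {S K ι N : Type*} [CommRing S] [Field K] [Fintype N]
    (φ ψ : S →+* K) (hφ : Function.Injective φ) (v : ι → N → S)
    (h : Submodule.span K (Set.range fun i => ψ ∘ v i) = ⊤) :
    Submodule.span K (Set.range fun i => φ ∘ v i) = ⊤ := by
  classical
  obtain ⟨κ, a, -, hspan, hli⟩ := exists_linearIndependent' K fun i => ψ ∘ v i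
  let b := Module.Basis.mk hli (by rw [hspan, h])
  let e := (Pi.basisFun K N).indexEquiv b
  let M : Matrix N N S := Matrix.of fun n => v (a (e n))
  have hli' : LinearIndependent K (M.map ψ).row := hli.comp e e.injective
  have hdet : (M.map ψ).det ≠ 0 := by
    rw [Matrix.linearIndependent_rows_iff_isUnit, Matrix.isUnit_iff_isUnit_det] at hli'
    exact hli'.ne_zero
  have hdet' : (M.map φ).det ≠ 0 := by
    have h1 : M.det ≠ 0 := by
      intro h0
      apply hdet
      rw [← RingHom.mapMatrix_apply, ← RingHom.map_det, h0, map_zero]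
    rw [← RingHom.mapMatrix_apply, ← RingHom.map_det]
    exact (map_ne_zero_iff φ hφ).2 h1
  have hli2 : LinearIndependent K (M.map φ).row := by
    rw [Matrix.linearIndependent_rows_iff_isUnit, Matrix.isUnit_iff_isUnit_det]
    exact isUnit_iff_ne_zero.2 hdet'
  have htop := hli2.span_eq_top_of_card_eq_finrank' (by simp)
  refine top_le_iff.1 (htop.symm.le.trans (Submodule.span_mono ?_))
  rintro _ ⟨n, rfl⟩
  exact ⟨a (e n), rfl⟩

/-! ### Graded pieces of homogeneous ideals -/

lemma expDeg_eq_degree {n : ℕ} (μ : Fin n →₀ ℕ) : expDeg μ = μ.degree := rfl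

section Graded

variable {K : Type*} [Field K] {m : ℕ}

lemma homogeneousSubmodule_eq_restrictSupport (t : ℕ) :
    homogeneousSubmodule (Fin m) K t = restrictSupport K {μ | μ.degree = t} :=
  homogeneousSubmodule_eq_finsupp_supported _ _ _

lemma finrank_restrictSupport (Θ : Set (Fin m →₀ ℕ)) :
    Module.finrank K (restrictSupport K Θ) = Θ.ncard := by
  rw [Module.finrank_eq_nat_card_basis (basisRestrictSupport K Θ), Nat.card_coe_set_eq]

lemma finiteDimensional_restrictSupport {Θ : Set (Fin m →₀ ℕ)} (h : Θ.Finite) :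
    FiniteDimensional K (restrictSupport K Θ) :=
  have := h.to_subtype
  Module.Basis.finiteDimensional_of_finite (basisRestrictSupport K Θ)

instance finiteDimensional_homogeneousSubmodule (t : ℕ) :
    FiniteDimensional K (homogeneousSubmodule (Fin m) K t) := by
  rw [homogeneousSubmodule_eq_restrictSupport]
  exact finiteDimensional_restrictSupport (Finsupp.finite_of_degree_eq t)

lemma homogeneousComponent_mul_of_isHomogeneous {g : MvPolynomial (Fin m) K} {D : ℕ}
    (hg : g.IsHomogeneous D) (p : MvPolynomial (Fin m) K) (t : ℕ) :
    homogeneousComponent (t + D) (g * p) = g * homogeneousComponent t p := by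
  conv_lhs => rw [← sum_homogeneousComponent p]
  rw [Finset.mul_sum, map_sum]
  have h1 : ∀ i, homogeneousComponent (t + D) (g * homogeneousComponent i p) =
      if t = i then g * homogeneousComponent t p else 0 := by
    intro i
    have : g * homogeneousComponent i p ∈ homogeneousSubmodule (Fin m) K (D + i) :=
      hg.mul (homogeneousComponent_isHomogeneous i p)
    rw [homogeneousComponent_of_mem this]
    by_cases h : t = i
    · subst h
      rw [if_pos (add_comm _ _), if_pos rfl]
    · rw [if_neg (by omega), if_neg h]
  simp only [h1, Finset.sum_ite_eq, Finset.mem_range]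
  split_ifs with h
  · rfl
  · rw [homogeneousComponent_eq_zero _ _ (by omega), mul_zero]

lemma homogeneousComponent_mul_eq_zero {g : MvPolynomial (Fin m) K} {D : ℕ}
    (hg : g.IsHomogeneous D) (p : MvPolynomial (Fin m) K) {t : ℕ} (ht : t < D) :
    homogeneousComponent t (g * p) = 0 := by
  conv_lhs => rw [← sum_homogeneousComponent p]
  rw [Finset.mul_sum, map_sum]
  refine Finset.sum_eq_zero fun i _ => ?_
  have : g * homogeneousComponent i p ∈ homogeneousSubmodule (Fin m) K (D + i) :=
    hg.mul (homogeneousComponent_isHomogeneous i p)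
  rw [homogeneousComponent_of_mem this, if_neg (by omega)]

variable {r : ℕ}

/-- The span of the monomial multiples of degree `N` of the forms `f i`, `i ∈ κ`, of
degree `d i`. -/
noncomputable def formSpan (f : Fin r → MvPolynomial (Fin m) K) (d : Fin r → ℕ)
    (κ : Set (Fin r)) (N : ℕ) : Submodule K (MvPolynomial (Fin m) K) :=
  Submodule.span K {x | ∃ i ∈ κ, ∃ β : Fin m →₀ ℕ, β.degree + d i = N ∧ x = monomial β 1 * f i}

lemma monomial_mul_mem_formSpan {f : Fin r → MvPolynomial (Fin m) K} {d : Fin r → ℕ}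
    {κ : Set (Fin r)} {N : ℕ} {p : MvPolynomial (Fin m) K} (hp : p ∈ formSpan f d κ N)
    (β : Fin m →₀ ℕ) (c : K) : monomial β c * p ∈ formSpan f d κ (N + β.degree) := by
  have : formSpan f d κ N ≤
      (formSpan f d κ (N + β.degree)).comap (LinearMap.mulLeft K (monomial β c)) := by
    refine Submodule.span_le.2 ?_
    rintro _ ⟨i, hi, γ, hγ, rfl⟩
    have h1 : monomial β c * (monomial γ 1 * f i) = c • (monomial (β + γ) 1 * f i) := by
      rw [← mul_assoc, monomial_mul, mul_one, ← smul_mul_assoc, smul_monomial, smul_eq_mul,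
        mul_one]
    simp only [Submodule.comap_coe, Set.mem_preimage, LinearMap.mulLeft_apply, SetLike.mem_coe]
    rw [h1]
    refine Submodule.smul_mem _ _ (Submodule.subset_span ⟨i, hi, β + γ, ?_, rfl⟩)
    rw [map_add]
    omega
  exact this hp

lemma mul_mem_formSpan {f : Fin r → MvPolynomial (Fin m) K} {d : Fin r → ℕ}
    {κ : Set (Fin r)} {N t : ℕ} {p q : MvPolynomial (Fin m) K} (hp : p ∈ formSpan f d κ N)
    (hq : q.IsHomogeneous t) : q * p ∈ formSpan f d κ (N + t) := by
  rw [q.as_sum, Finset.sum_mul]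
  refine sum_mem fun β hβ => ?_
  have hβt : β.degree = t := (hq.degree_eq_sum_deg_support hβ).symm
  rw [← hβt]
  exact monomial_mul_mem_formSpan hp _ _

lemma formSpan_le_homogeneousSubmodule {f : Fin r → MvPolynomial (Fin m) K} {d : Fin r → ℕ}
    (hf : ∀ i, (f i).IsHomogeneous (d i)) (κ : Set (Fin r)) (N : ℕ) :
    formSpan f d κ N ≤ homogeneousSubmodule (Fin m) K N := by
  refine Submodule.span_le.2 ?_
  rintro _ ⟨i, _, β, hβ, rfl⟩
  rw [← hβ]
  exact (isHomogeneous_monomial 1 rfl).mul (hf i)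

lemma homogeneousComponent_mem_formSpan {f : Fin r → MvPolynomial (Fin m) K} {d : Fin r → ℕ}
    (hf : ∀ i, (f i).IsHomogeneous (d i)) {κ : Set (Fin r)} {p : MvPolynomial (Fin m) K}
    (hp : p ∈ Ideal.span (f '' κ)) (N : ℕ) : homogeneousComponent N p ∈ formSpan f d κ N := by
  induction hp using Submodule.span_induction generalizing N with
  | mem x hx =>
    obtain ⟨i, hi, rfl⟩ := hx
    rw [homogeneousComponent_of_mem ((mem_homogeneousSubmodule _ _).2 (hf i))]
    split_ifs with h
    · exact Submodule.subset_span ⟨i, hi, 0, by simp [h], by simp⟩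
    · exact zero_mem _
  | zero => simp
  | add x y _ _ hx hy =>
    rw [map_add]
    exact add_mem (hx N) (hy N)
  | smul a x _ hx =>
    rw [smul_eq_mul, a.as_sum, Finset.sum_mul, map_sum]
    refine sum_mem fun β _ => ?_
    have hβ : (monomial β (coeff β a)).IsHomogeneous β.degree := isHomogeneous_monomial _ rfl
    by_cases h : N < β.degree
    · rw [homogeneousComponent_mul_eq_zero hβ _ h]
      exact zero_mem _
    · obtain ⟨t, rfl⟩ := Nat.exists_eq_add_of_le' (not_lt.1 h)
      rw [homogeneousComponent_mul_of_isHomogeneous hβ]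
      exact monomial_mul_mem_formSpan (hx t) _ _

lemma formSpan_le_span (f : Fin r → MvPolynomial (Fin m) K) (d : Fin r → ℕ)
    (κ : Set (Fin r)) (N : ℕ) :
    formSpan f d κ N ≤ (Ideal.span (f '' κ)).restrictScalars K := by
  refine Submodule.span_le.2 ?_
  rintro _ ⟨i, hi, β, _, rfl⟩
  exact Ideal.mul_mem_left _ _ (Ideal.subset_span ⟨i, hi, rfl⟩)

lemma mem_formSpan_iff {f : Fin r → MvPolynomial (Fin m) K} {d : Fin r → ℕ}
    (hf : ∀ i, (f i).IsHomogeneous (d i)) {κ : Set (Fin r)} {N : ℕ}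
    {p : MvPolynomial (Fin m) K} (hp : p.IsHomogeneous N) :
    p ∈ formSpan f d κ N ↔ p ∈ Ideal.span (f '' κ) := by
  refine ⟨fun h => formSpan_le_span f d κ N h, fun h => ?_⟩
  have := homogeneousComponent_mem_formSpan hf h N
  rwa [homogeneousComponent_of_mem ((mem_homogeneousSubmodule _ _).2 hp), if_pos rfl] at this

/-- If the forms of degree `N` are spanned by some given monomials and the multiples of some
forms `f₀ i`, then the same holds for generic forms `f i` of the same degrees. -/
lemma homogeneousSubmodule_le_formSpan_of_generic {F : Type*} [Field F] [Algebra F K]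
    {f f₀ : Fin r → MvPolynomial (Fin m) K} {d : Fin r → ℕ} (hf : IsGenericSeq F d f)
    {κ : Set (Fin r)} {N : ℕ} {Θ : Set (Fin m →₀ ℕ)}
    (h : homogeneousSubmodule (Fin m) K N ≤ formSpan f₀ d κ N ⊔ restrictSupport K Θ) :
    homogeneousSubmodule (Fin m) K N ≤ formSpan f d κ N ⊔ restrictSupport K Θ := by
  classical
  let E := {μ : Fin m →₀ ℕ // μ.degree = N}
  have hE : Finite E := (Finsupp.finite_of_degree_eq N).to_subtype
  have := Fintype.ofFinite E
  let σ := Σ i : Fin r, {μ : Fin m →₀ ℕ // expDeg μ = d i}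
  let S := MvPolynomial σ F
  let ι₁ := {x : Fin r × (Fin m →₀ ℕ) // x.1 ∈ κ ∧ x.2.degree + d x.1 = N}
  let ι₂ := {θ : E // θ.1 ∈ Θ}
  let v : ι₁ ⊕ ι₂ → E → S := Sum.elim
    (fun x μ => if h : x.1.2 ≤ μ.1 then X ⟨x.1.1, ⟨μ.1 - x.1.2, by
        have h1 := congrArg Finsupp.degree (tsub_add_cancel_of_le h)
        have h2 := x.2.2
        have h3 := μ.2
        rw [map_add] at h1
        rw [expDeg_eq_degree]
        omega⟩⟩ else 0)
    (fun θ μ => if μ = θ.1 then 1 else 0)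
  let ev : (Fin r → MvPolynomial (Fin m) K) → S →+* K := fun g =>
    (aeval fun p : σ => (g p.1).coeff p.2.1 : S →ₐ[F] K).toRingHom
  let π : MvPolynomial (Fin m) K →ₗ[K] (E → K) := LinearMap.pi fun μ => lcoeff K μ.1
  let w : (Fin r → MvPolynomial (Fin m) K) → ι₁ ⊕ ι₂ → MvPolynomial (Fin m) K := fun g =>
    Sum.elim (fun x => monomial x.1.2 1 * g x.1.1) (fun θ => monomial θ.1.1 1)
  have hw : ∀ g i, ev g ∘ v i = π (w g i) := by
    intro g i
    ext μ
    rcases i with x | θ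
    · simp only [Function.comp, v, w, π, ev, Sum.elim_inl, LinearMap.pi_apply, lcoeff_apply,
        coeff_monomial_mul', one_mul, AlgHom.toRingHom_eq_coe, RingHom.coe_coe]
      split_ifs
      · rw [aeval_X]
      · rw [map_zero]
    · simp only [Function.comp, v, w, π, ev, Sum.elim_inr, LinearMap.pi_apply, lcoeff_apply,
        coeff_monomial, AlgHom.toRingHom_eq_coe, RingHom.coe_coe]
      by_cases h : μ = θ.1
      · rw [if_pos h, if_pos (by rw [h]), map_one]
      · rw [if_neg h, if_neg fun h' => h (Subtype.ext h'.symm), map_zero]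
  have hπ : ∀ p ∈ homogeneousSubmodule (Fin m) K N, π p = 0 → p = 0 := by
    intro p hp h0
    ext μ
    by_cases hμ : μ.degree = N
    · exact congrFun h0 ⟨μ, hμ⟩
    · simpa using IsHomogeneous.coeff_eq_zero hp hμ
  have hspan₀ : Submodule.span K (Set.range fun i => ev f₀ ∘ v i) = ⊤ := by
    have hmap : (formSpan f₀ d κ N ⊔ restrictSupport K Θ).map π ≤
        Submodule.span K (Set.range fun i => ev f₀ ∘ v i) := by
      rw [Submodule.map_sup, formSpan, Submodule.map_span, restrictSupport_eq_span,
        Submodule.map_span]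
      refine sup_le (Submodule.span_le.2 ?_) (Submodule.span_le.2 ?_)
      · rintro _ ⟨_, ⟨i, hi, β, hβ, rfl⟩, rfl⟩
        exact Submodule.subset_span ⟨Sum.inl ⟨(i, β), hi, hβ⟩, hw _ _⟩
      · rintro _ ⟨_, ⟨θ, hθ, rfl⟩, rfl⟩
        by_cases hN : θ.degree = N
        · exact Submodule.subset_span ⟨Sum.inr ⟨⟨θ, hN⟩, hθ⟩, hw _ _⟩
        · have : π (monomial θ 1) = 0 := by
            ext μ
            simp only [π, LinearMap.pi_apply, lcoeff_apply, coeff_monomial, Pi.zero_apply]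
            rw [if_neg]
            rintro rfl
            exact hN μ.2
          simp only [SetLike.mem_coe]
          rw [this]
          exact zero_mem _
    refine top_le_iff.1 fun x _ => hmap ?_
    refine ⟨∑ μ : E, monomial μ.1 (x μ), h ?_, ?_⟩
    · exact sum_mem fun μ _ => isHomogeneous_monomial _ μ.2
    · ext μ
      simp only [π, LinearMap.pi_apply, lcoeff_apply, coeff_sum, coeff_monomial]
      rw [Finset.sum_eq_single μ (fun b _ hb => if_neg fun h' => hb (Subtype.ext h'))
        (fun h' => absurd (Finset.mem_univ _) h'), if_pos rfl]
  have hinj : Function.Injective (ev f) := hf.2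
  have hspan := span_range_eq_top_of_specialization (ev f) (ev f₀) hinj v hspan₀
  intro p hp
  have h1 : π p ∈ Submodule.span K (Set.range fun i => ev f ∘ v i) := hspan ▸ Submodule.mem_top
  have h2 : (Set.range fun i => ev f ∘ v i) = π '' Set.range (w f) := by
    rw [← Set.range_comp]
    exact congrArg Set.range (funext fun i => hw f i)
  rw [h2, ← Submodule.map_span] at h1
  obtain ⟨q, hq, hqp⟩ := h1
  have hq1 : q ∈ homogeneousSubmodule (Fin m) K N := by
    refine (Submodule.span_le.2 ?_ : Submodule.span K (Set.range (w f)) ≤ _) hq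
    rintro _ ⟨x | θ, rfl⟩
    · exact formSpan_le_homogeneousSubmodule hf.1 κ N
        (Submodule.subset_span ⟨x.1.1, x.2.1, x.1.2, x.2.2, rfl⟩)
    · exact isHomogeneous_monomial _ θ.1.2
  have hq2 : q ∈ formSpan f d κ N ⊔ restrictSupport K Θ := by
    refine (Submodule.span_le.2 ?_ : Submodule.span K (Set.range (w f)) ≤ _) hq
    rintro _ ⟨x | θ, rfl⟩
    · exact (le_sup_left : _ ≤ formSpan f d κ N ⊔ restrictSupport K Θ)
        (Submodule.subset_span ⟨x.1.1, x.2.1, x.1.2, x.2.2, rfl⟩)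
    · refine (le_sup_right : _ ≤ formSpan f d κ N ⊔ restrictSupport K Θ) ?_
      rw [restrictSupport_eq_span]
      exact Submodule.subset_span ⟨θ.1.1, θ.2, rfl⟩
  have : p = q := sub_eq_zero.1 (hπ _ (sub_mem hp hq1) (by rw [map_sub, hqp, sub_self]))
  rw [this]
  exact hq2

end Graded

/-! ### Toeplitz coefficients -/

/-- The homogenised binary form `∑ c_l y^l z^(d-l)` evaluated at two elements of an algebra. -/
def binaryForm {K P : Type*} [CommSemiring K] [CommSemiring P] [Algebra K P]
    (d : ℕ) (c : ℕ → K) (y z : P) : P :=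
  ∑ l ∈ Finset.range (d + 1), c l • (y ^ l * z ^ (d - l))

/-- The square Toeplitz matrix of size `s` with entries `c (r + a - i)`. -/
def toeplitz {R : Type*} [Zero R] (c : ℕ → R) (r s : ℕ) : Matrix (Fin s) (Fin s) R :=
  Matrix.of fun a i => if (i : ℕ) ≤ r + a then c (r + a - i) else 0

lemma toeplitz_single {R : Type*} [Zero R] [One R] (r s : ℕ) :
    toeplitz (Pi.single r (1 : R)) r s = 1 := by
  ext a i
  simp only [toeplitz, Matrix.of_apply, Matrix.one_apply, Pi.single_apply, Fin.ext_iff]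
  split_ifs <;> first | rfl | omega

lemma map_toeplitz {R S : Type*} [Semiring R] [Semiring S] (φ : R →+* S) (c : ℕ → R) (r s : ℕ) :
    (toeplitz c r s).map φ = toeplitz (φ ∘ c) r s := by
  ext a i
  simp only [toeplitz, Matrix.map_apply, Matrix.of_apply, Function.comp]
  split_ifs <;> simp

lemma exists_toeplitz_det_ne_zero (K : Type*) [Field K] [Infinite K] (d m : ℕ) :
    ∃ c : ℕ → K, (∀ l, d < l → c l = 0) ∧
      ∀ r ≤ d, ∀ s ≤ m, (toeplitz c r s).det ≠ 0 := by
  let x : ℕ → MvPolynomial ℕ K := fun l => if l ≤ d then X l else 0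
  let Q : MvPolynomial ℕ K :=
    ∏ r ∈ Finset.range (d + 1), ∏ s ∈ Finset.range (m + 1), (toeplitz x r s).det
  have heval : ∀ (v : ℕ → K) (r s : ℕ), eval v (toeplitz x r s).det =
      (toeplitz (fun l => if l ≤ d then v l else 0) r s).det := by
    intro v r s
    rw [RingHom.map_det, RingHom.mapMatrix_apply, map_toeplitz]
    congr 2
    ext l
    simp only [x, Function.comp]
    split_ifs <;> simp
  have hQ : Q ≠ 0 := by
    refine Finset.prod_ne_zero_iff.2 fun r hr => Finset.prod_ne_zero_iff.2 fun s _ h0 => ?_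
    have h1 := heval (Pi.single r 1) r s
    have h2 : (fun l => if l ≤ d then (Pi.single r (1 : K) : ℕ → K) l else 0) =
        Pi.single r 1 := by
      ext l
      have := Finset.mem_range.1 hr
      by_cases hl : l = r
      · subst hl; simp; omega
      · simp [hl]
    rw [h2, toeplitz_single, h0] at h1
    simp at h1
  obtain ⟨v, hv⟩ : ∃ v, eval v Q ≠ 0 := by
    by_contra! h
    exact hQ (MvPolynomial.funext fun v => by simpa using h v)
  refine ⟨fun l => if l ≤ d then v l else 0, fun l hl => by simp [not_le.2 hl], ?_⟩
  intro r hr s hs h0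
  apply hv
  rw [map_prod]
  refine Finset.prod_eq_zero (Finset.mem_range.2 (Nat.lt_succ_of_le hr)) ?_
  rw [map_prod]
  exact Finset.prod_eq_zero (Finset.mem_range.2 (Nat.lt_succ_of_le hs)) (by rw [heval, h0])

lemma binaryForm_mul_monomial {K P : Type*} [CommRing K] [CommRing P] [Algebra K P]
    {d : ℕ} {c : ℕ → K} (hc : ∀ l, d < l → c l = 0) (y z : P) {i w : ℕ} (hi : i ≤ w) :
    binaryForm d c y z * (y ^ i * z ^ (w - i)) =
      ∑ A ∈ Finset.range (w + d + 1),
        (if i ≤ A then c (A - i) else 0) • (y ^ A * z ^ (w + d - A)) := by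
  have h1 : ∑ A ∈ Finset.range (w + d + 1),
        (if i ≤ A then c (A - i) else 0) • (y ^ A * z ^ (w + d - A)) =
      ∑ A ∈ (Finset.range (d + 1)).image (· + i),
        (if i ≤ A then c (A - i) else 0) • (y ^ A * z ^ (w + d - A)) := by
    symm
    apply Finset.sum_subset
    · intro A
      simp only [Finset.mem_image, Finset.mem_range]
      rintro ⟨l, hl, rfl⟩
      omega
    · intro A _ hA
      split_ifs with hiA
      · rw [hc, zero_smul]
        by_contra! h
        exact hA (Finset.mem_image.2 ⟨A - i, Finset.mem_range.2 (by omega), by omega⟩)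
      · rw [zero_smul]
  rw [h1, Finset.sum_image (fun a _ b _ h => by simpa using h), binaryForm, Finset.sum_mul]
  refine Finset.sum_congr rfl fun l hl => ?_
  have hl' := Finset.mem_range.1 hl
  simp only [Nat.le_add_left, if_true, Nat.add_sub_cancel, smul_mul_assoc]
  congr 1
  rw [show w + d - (l + i) = (d - l) + (w - i) by omega, pow_add, pow_add]
  ring

/-- A multiple of the binary form whose only term `y^A z^*` with `r ≤ A < k` is `y^r z^*`. -/
lemma exists_binaryForm_multiple {K P : Type*} [Field K] [CommRing P] [Algebra K P]
    {d : ℕ} {c : ℕ → K} (hc : ∀ l, d < l → c l = 0) (y z : P) {r k : ℕ} (hrk : r < k)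
    (hdet : (toeplitz c r (k - r)).det ≠ 0) :
    ∃ (G : P) (β : ℕ → K), β r = 1 ∧ (∀ A, r < A → A < k → β A = 0) ∧
      binaryForm d c y z * G =
        ∑ A ∈ Finset.range (k - 1 - r + d + 1), β A • (y ^ A * z ^ (k - 1 - r + d - A)) := by
  have h0 : 0 < k - r := by omega
  set M := toeplitz c r (k - r) with hM
  set u : Fin (k - r) → K := M⁻¹.mulVec (Pi.single ⟨0, h0⟩ 1) with hu
  have hMu : M.mulVec u = Pi.single ⟨0, h0⟩ 1 := by
    rw [hu, Matrix.mulVec_mulVec, Matrix.mul_nonsing_inv _ (isUnit_iff_ne_zero.2 hdet),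
      Matrix.one_mulVec]
  have hrow : ∀ a : Fin (k - r),
      ∑ i : Fin (k - r), u i * (if (i : ℕ) ≤ r + a then c (r + a - i) else 0) =
        (Pi.single ⟨0, h0⟩ 1 : Fin (k - r) → K) a := by
    intro a
    rw [← hMu]
    simp only [Matrix.mulVec, dotProduct, hM, toeplitz, Matrix.of_apply]
    exact Finset.sum_congr rfl fun i _ => mul_comm _ _
  refine ⟨∑ i : Fin (k - r), u i • (y ^ (i : ℕ) * z ^ (k - 1 - r - i)),
    fun A => ∑ i : Fin (k - r), u i * (if (i : ℕ) ≤ A then c (A - i) else 0), ?_, ?_, ?_⟩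
  · simpa using hrow ⟨0, h0⟩
  · intro A h1 h2
    have := hrow ⟨A - r, by omega⟩
    simp only [show r + (A - r) = A by omega] at this
    refine this.trans (Pi.single_eq_of_ne ?_ _)
    simp only [ne_eq, Fin.ext_iff]
    omega
  · rw [Finset.mul_sum]
    simp only [Finset.sum_smul]
    rw [Finset.sum_comm]
    refine Finset.sum_congr rfl fun i _ => ?_
    rw [mul_smul_comm, binaryForm_mul_monomial hc y z (by have := i.2; omega), Finset.smul_sum]
    exact Finset.sum_congr rfl fun A _ => smul_smul _ _ _

/-! ### Propagation of the Lefschetz property along a chain of binary forms -/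

section Chain

variable {K P : Type*} [Field K] [CommRing P] [Algebra K P]

/-- Surjectivity part of the strong Lefschetz property for multiplication by `y`, modulo the
ideal `I`: the space `H σ` plays the role of the forms of degree `σ` not involving `y`. -/
def LefschetzMod (I : Ideal P) (y : P) (H : ℕ → Submodule K P) (E : ℕ) : Prop :=
  ∀ r σ : ℕ, E + 1 ≤ r + 2 * σ → ∀ h ∈ H σ,
    y ^ r * h ∈ I.restrictScalars K ⊔
      Submodule.span K {x | ∃ σ' < σ, ∃ h' ∈ H σ', x = y ^ (r + σ - σ') * h'}

/-- Adjoin the powers of `y` to a family of spaces. -/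
def adjoinPowers (y : P) (H : ℕ → Submodule K P) (s : ℕ) : Submodule K P :=
  Submodule.span K {x | ∃ r σ, r + σ = s ∧ ∃ h ∈ H σ, x = y ^ r * h}

lemma mul_mem_of_mem_sup_span {I : Ideal P} {S : Set P} {W : Submodule K P} {x : P} (a : P)
    (hI : I.restrictScalars K ≤ W) (hS : ∀ s ∈ S, a * s ∈ W)
    (hx : x ∈ I.restrictScalars K ⊔ Submodule.span K S) : a * x ∈ W := by
  obtain ⟨u, hu, v, hv, rfl⟩ := Submodule.mem_sup.1 hx
  rw [mul_add]
  refine add_mem (hI (I.mul_mem_left a hu)) ?_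
  have : Submodule.span K S ≤ W.comap (LinearMap.mulLeft K a) :=
    Submodule.span_le.2 fun s hs => hS s hs
  exact this hv

lemma LefschetzMod.monomial_mem {I : Ideal P} {y z : P} {H : ℕ → Submodule K P} {E d : ℕ}
    {c : ℕ → K} (hL : LefschetzMod I y H E) (hc : ∀ l, d < l → c l = 0)
    (hF : binaryForm d c y z ∈ I) (hdet : ∀ r ≤ d, ∀ s ≤ E + 1, (toeplitz c r s).det ≠ 0)
    {N b₀ : ℕ} (hN : E + d + b₀ ≤ 2 * N) (σ b r : ℕ) (hbr : b + r + σ = N) (h : P)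
    (hh : h ∈ H σ) :
    z ^ b * (y ^ r * h) ∈ I.restrictScalars K ⊔
      Submodule.span K {x | ∃ b r σ, b₀ < b ∧ b + r + σ = N ∧ ∃ h ∈ H σ,
        x = z ^ b * (y ^ r * h)} := by
  set W := I.restrictScalars K ⊔
      Submodule.span K {x | ∃ b r σ, b₀ < b ∧ b + r + σ = N ∧ ∃ h ∈ H σ,
        x = z ^ b * (y ^ r * h)} with hW
  have hIW : I.restrictScalars K ≤ W := le_sup_left
  induction σ using Nat.strong_induction_on generalizing b r h with
  | _ σ ihσ =>
  have hlow : ∀ b r h, b + r + σ = N → h ∈ H σ → E + 1 ≤ r + 2 * σ →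
      z ^ b * (y ^ r * h) ∈ W := by
    intro b r h hbr hh hr
    refine mul_mem_of_mem_sup_span _ hIW ?_ (hL r σ hr h hh)
    rintro _ ⟨σ', hσ', h', hh', rfl⟩
    exact ihσ σ' hσ' b _ (by omega) h' hh'
  obtain ⟨t, ht⟩ : ∃ t, t = b₀ + 1 - b := ⟨_, rfl⟩
  induction t using Nat.strong_induction_on generalizing b r with
  | _ t iht =>
  by_cases hb : b₀ < b
  · exact (le_sup_right : _ ≤ W) (Submodule.subset_span ⟨b, r, σ, hb, hbr, h, hh, rfl⟩)
  by_cases hr : E + 1 ≤ r + 2 * σ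
  · exact hlow b r h hbr hh hr
  have key : ∀ r₀ k e w : ℕ, r₀ < k → r₀ ≤ d → k ≤ E + 1 → w + (k - 1 - r₀ + d - r₀) = b →
      e + r₀ = r → (∀ A, k ≤ A → A ≤ k - 1 - r₀ + d → E + 1 ≤ e + A + 2 * σ) →
      z ^ b * (y ^ r * h) ∈ W := by
    intro r₀ k e w hk hd hkE hw he hA
    obtain ⟨G, β, hβ, hβ0, hG⟩ :=
      exists_binaryForm_multiple hc y z hk (hdet r₀ hd (k - r₀) (by omega))
    have hmem : (z ^ w * y ^ e * h) * (binaryForm d c y z * G) ∈ W :=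
      hIW (I.mul_mem_left _ (I.mul_mem_right _ hF))
    have hterm : ∀ A ≤ k - 1 - r₀ + d, (z ^ w * y ^ e * h) *
        (β A • (y ^ A * z ^ (k - 1 - r₀ + d - A))) =
        β A • (z ^ (w + (k - 1 - r₀ + d - A)) * (y ^ (e + A) * h)) := by
      intro A _
      rw [mul_smul_comm, pow_add, pow_add]
      congr 1
      ring
    have hr₀ : r₀ ∈ Finset.range (k - 1 - r₀ + d + 1) := Finset.mem_range.2 (by omega)
    rw [hG, Finset.mul_sum, ← Finset.add_sum_erase _ _ hr₀, hterm r₀ (by omega), hβ, one_smul,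
      hw, he] at hmem
    refine (Submodule.add_mem_iff_left W ?_).1 hmem
    refine sum_mem fun A hA' => ?_
    have hA1 := (Finset.mem_erase.1 hA').1
    have hA2 := Finset.mem_range.1 (Finset.mem_erase.1 hA').2
    rw [hterm A (by omega)]
    rcases lt_or_gt_of_ne hA1 with hlt | hgt
    · exact W.smul_mem _ (iht _ (by omega) _ _ (by omega) rfl)
    · by_cases hAk : A < k
      · rw [hβ0 A hgt hAk, zero_smul]
        exact W.zero_mem
      · exact W.smul_mem _ (hlow _ _ h (by omega) hh (hA A (by omega) (by omega)))
  by_cases hrd : r ≤ d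
  · exact key r (E + 1 - 2 * σ) 0 (b - (E + 1 - 2 * σ - 1 - r + d - r)) (by omega) hrd (by omega)
      (by omega) (by omega) (by intros; omega)
  · exact key d (d + 1) (r - d) b (by omega) le_rfl (by omega) (by omega) (by omega)
      (by intros; omega)

lemma LefschetzMod.adjoin {I : Ideal P} {y z : P} {H : ℕ → Submodule K P} {E d : ℕ} {c : ℕ → K}
    (hL : LefschetzMod I y H E) (hd : 1 ≤ d) (hc : ∀ l, d < l → c l = 0)
    (hF : binaryForm d c y z ∈ I) (hdet : ∀ r ≤ d, ∀ s ≤ E + 1, (toeplitz c r s).det ≠ 0) :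
    LefschetzMod I z (adjoinPowers y H) (E + (d - 1)) := by
  intro b s hbs q hq
  refine mul_mem_of_mem_sup_span (I := I) (z ^ b) le_sup_left ?_
    ((le_sup_right : _ ≤ I.restrictScalars K ⊔ _) hq)
  rintro _ ⟨r, σ, rfl, h, hh, rfl⟩
  refine SetLike.le_def.1 (sup_le_sup le_rfl ?_) (hL.monomial_mem hc hF hdet (N := b + (r + σ))
    (b₀ := b) (by omega) σ b r (by omega) h hh)
  refine Submodule.span_mono ?_
  rintro _ ⟨b', r', σ', hb, hN, h', hh', rfl⟩
  refine ⟨r' + σ', by omega, y ^ r' * h', Submodule.subset_span ⟨r', σ', rfl, h', hh', rfl⟩, ?_⟩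
  rw [show b + (r + σ) - (r' + σ') = b' by omega]

end Chain

/-! ### The Lefschetz-type property of generic forms -/

section ChainVariables

variable (K : Type*) [Field K] (n : ℕ)

/-- The variables `0, x_1, x_2, …` of the polynomial ring, as a sequence starting with `0`. -/
noncomputable def chainVar : ℕ → MvPolynomial (Fin (n + 1)) K
  | 0 => 0
  | i + 1 => if h : i < n + 1 then X ⟨i, h⟩ else 0

/-- The forms of degree `s` in the first `i - 1` variables. -/
noncomputable def chainSpace : ℕ → ℕ → Submodule K (MvPolynomial (Fin (n + 1)) K)
  | 0 => fun s => if s = 0 then Submodule.span K {1} else ⊥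
  | i + 1 => adjoinPowers (chainVar K n i) (chainSpace i)

variable {K n}

lemma chainSpace_zero (s : ℕ) :
    chainSpace K n 0 s = if s = 0 then Submodule.span K {1} else ⊥ := rfl

lemma isHomogeneous_chainVar (i : ℕ) : (chainVar K n i).IsHomogeneous 1 := by
  rcases i with _ | i
  · exact isHomogeneous_zero _ _ _
  · rw [chainVar]
    split_ifs
    · exact isHomogeneous_X _ _
    · exact isHomogeneous_zero _ _ _

lemma chainSpace_le_homogeneousSubmodule (i s : ℕ) :
    chainSpace K n i s ≤ homogeneousSubmodule (Fin (n + 1)) K s := by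
  induction i generalizing s with
  | zero =>
    rw [chainSpace_zero]
    split_ifs with h
    · rw [h, Submodule.span_singleton_le_iff_mem]
      exact isHomogeneous_one _ _
    · exact bot_le
  | succ i ih =>
    refine Submodule.span_le.2 ?_
    rintro _ ⟨r, σ, rfl, h, hh, rfl⟩
    have := ((isHomogeneous_chainVar (K := K) (n := n) i).pow r).mul (ih σ hh)
    rwa [one_mul] at this

lemma monomial_mem_chainSpace (i : ℕ) (hi : i ≤ n + 1) (β : Fin (n + 1) →₀ ℕ)
    (hβ : ∀ j : Fin (n + 1), i ≤ j.val + 1 → β j = 0) :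
    monomial β 1 ∈ chainSpace K n i β.degree := by
  induction i generalizing β with
  | zero =>
    obtain rfl : β = 0 := Finsupp.ext fun j => hβ j (Nat.zero_le _)
    rw [chainSpace_zero, map_zero, if_pos rfl]
    exact Submodule.mem_span_singleton_self _
  | succ i ih =>
    rcases i with _ | i
    · obtain rfl : β = 0 := Finsupp.ext fun j => hβ j (by omega)
      refine Submodule.subset_span ⟨0, 0, by simp, 1, ?_, by simp⟩
      rw [chainSpace_zero, if_pos rfl]
      exact Submodule.mem_span_singleton_self _
    · have hin : i < n + 1 := by omega
      have h1 : β.erase ⟨i, hin⟩ + Finsupp.single ⟨i, hin⟩ (β ⟨i, hin⟩) = β :=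
        Finsupp.erase_add_single _ _
      have h2 := congrArg Finsupp.degree h1
      rw [map_add, Finsupp.degree_single] at h2
      refine Submodule.subset_span ⟨β ⟨i, hin⟩, (β.erase ⟨i, hin⟩).degree, by omega,
        monomial (β.erase ⟨i, hin⟩) 1, ih (by omega) _ fun j hj => ?_, ?_⟩
      · by_cases hji : j = ⟨i, hin⟩
        · rw [hji, Finsupp.erase_same]
        · have : j.val ≠ i := fun h => hji (Fin.ext h)
          rw [Finsupp.erase_ne hji]
          exact hβ j (by omega)
      · rw [chainVar, dif_pos hin, X_pow_eq_monomial, monomial_mul, one_mul,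
          add_comm (Finsupp.single _ _), h1]

lemma lefschetzMod_chainSpace {d : Fin (n + 1) → ℕ} (hd : ∀ i, 1 ≤ d i)
    {I : Ideal (MvPolynomial (Fin (n + 1)) K)} {c : Fin (n + 1) → ℕ → K} {M : ℕ}
    (hM : ∑ i, (d i - 1) + 1 ≤ M) (hc : ∀ i l, d i < l → c i l = 0)
    (hdet : ∀ i, ∀ r ≤ d i, ∀ s ≤ M, (toeplitz (c i) r s).det ≠ 0)
    (hI : ∀ i : Fin (n + 1), binaryForm (d i) (c i) (chainVar K n i) (chainVar K n (i + 1)) ∈ I)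
    (i : ℕ) (hi : i ≤ n + 1) :
    LefschetzMod I (chainVar K n i) (chainSpace K n i)
      (∑ j ∈ Finset.univ.filter (fun j : Fin (n + 1) => j.val < i), (d j - 1)) := by
  induction i with
  | zero =>
    intro r σ hr h hh
    rw [chainSpace_zero] at hh
    split_ifs at hh with hσ
    · have : r ≠ 0 := by
        rintro rfl
        simp [hσ] at hr
      rw [chainVar, zero_pow this, zero_mul]
      exact zero_mem _
    · rw [(Submodule.mem_bot _).1 hh, mul_zero]
      exact zero_mem _
  | succ i ih =>
    have h1 : Finset.univ.filter (fun j : Fin (n + 1) => j.val < i + 1) =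
        insert ⟨i, hi⟩ (Finset.univ.filter fun j : Fin (n + 1) => j.val < i) := by
      ext j
      simp only [Finset.mem_filter, Finset.mem_univ, true_and, Finset.mem_insert, Fin.ext_iff]
      omega
    have h2 := Finset.sum_le_univ_sum_of_nonneg
      (s := Finset.univ.filter fun j : Fin (n + 1) => j.val < i)
      (f := fun j => d j - 1) (fun _ => Nat.zero_le _)
    rw [h1, Finset.sum_insert (by simp), add_comm (d _ - 1)]
    exact (ih (by omega)).adjoin (hd ⟨i, hi⟩) (hc _) (hI ⟨i, hi⟩)
      fun r hr s hs => hdet _ r hr s (by omega)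

lemma homogeneousSubmodule_le_of_lefschetzMod {I : Ideal (MvPolynomial (Fin (n + 1)) K)}
    {E N b : ℕ} (hL : LefschetzMod I (X (Fin.last n)) (chainSpace K n (n + 1)) E)
    (hN : E + 1 + b ≤ 2 * N) :
    homogeneousSubmodule (Fin (n + 1)) K N ≤ I.restrictScalars K ⊔
      restrictSupport K {θ : Fin (n + 1) →₀ ℕ | θ.degree = N ∧ b < θ (Fin.last n)} := by
  set W := I.restrictScalars K ⊔
    restrictSupport K {θ : Fin (n + 1) →₀ ℕ | θ.degree = N ∧ b < θ (Fin.last n)} with hW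
  have key : ∀ t c : ℕ, c + t = b + 1 →
      restrictSupport K {θ : Fin (n + 1) →₀ ℕ | θ.degree = N ∧ c ≤ θ (Fin.last n)} ≤ W := by
    intro t
    induction t with
    | zero =>
      rintro _ rfl
      exact le_sup_right
    | succ t ih =>
      intro c hc
      rw [restrictSupport_eq_span]
      refine Submodule.span_le.2 ?_
      rintro _ ⟨θ, ⟨hθ, hcθ⟩, rfl⟩
      rcases hcθ.lt_or_eq with hlt | heq
      · refine ih (c + 1) (by omega) ?_
        rw [restrictSupport_eq_span]
        exact Submodule.subset_span ⟨θ, ⟨hθ, hlt⟩, rfl⟩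
      · have h1 : θ.erase (Fin.last n) + Finsupp.single (Fin.last n) c = θ := by
          rw [heq]
          exact Finsupp.erase_add_single _ _
        have h2 := congrArg Finsupp.degree h1
        rw [map_add, Finsupp.degree_single, hθ] at h2
        have h3 : monomial (θ.erase (Fin.last n)) 1 ∈
            chainSpace K n (n + 1) (θ.erase (Fin.last n)).degree := by
          refine monomial_mem_chainSpace _ le_rfl _ fun j hj => ?_
          have : j = Fin.last n := Fin.ext (by simp; omega)
          rw [this, Finsupp.erase_same]
        have h4 := hL c _ (by omega) _ h3
        rw [X_pow_eq_monomial, monomial_mul, one_mul, add_comm (Finsupp.single _ _), h1] at h4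
        refine (sup_le le_sup_left (Submodule.span_le.2 ?_) : _ ≤ W) h4
        rintro _ ⟨σ', hσ', h', hh', rfl⟩
        refine ih (c + 1) (by omega) ?_
        have h5 : h'.IsHomogeneous σ' := chainSpace_le_homogeneousSubmodule _ _ hh'
        intro μ hμ
        have h6 : ((X (Fin.last n) : MvPolynomial (Fin (n + 1)) K) ^
            (c + (θ.erase (Fin.last n)).degree - σ') * h').IsHomogeneous N := by
          have := ((isHomogeneous_X K (Fin.last n)).pow
            (c + (θ.erase (Fin.last n)).degree - σ')).mul h5
          rwa [show 1 * (c + (θ.erase (Fin.last n)).degree - σ') + σ' = N by omega] at this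
        have h7 : coeff μ ((X (Fin.last n) : MvPolynomial (Fin (n + 1)) K) ^
            (c + (θ.erase (Fin.last n)).degree - σ') * h') ≠ 0 := mem_support_iff.1 hμ
        refine ⟨?_, ?_⟩
        · by_contra h8
          exact h7 (h6.coeff_eq_zero h8)
        · rw [X_pow_eq_monomial, coeff_monomial_mul'] at h7
          have h8 : Finsupp.single (Fin.last n) (c + (θ.erase (Fin.last n)).degree - σ') ≤ μ := by
            by_contra h9
            exact h7 (if_neg h9)
          have := h8 (Fin.last n)
          rw [Finsupp.single_eq_same] at this
          omega
  refine le_trans ?_ (key (b + 1) 0 (by omega))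
  rw [homogeneousSubmodule_eq_restrictSupport]
  exact restrictSupport_mono _ fun θ hθ => ⟨hθ, Nat.zero_le _⟩

/-- Modulo sufficiently generic forms, every monomial of degree `N` is congruent to a combination
of monomials of larger exponent in the last variable. -/
lemma homogeneousSubmodule_le_formSpan_sup {F : Type*} [Field F] [Algebra F K] [Infinite K]
    {d : Fin (n + 1) → ℕ} (hd : ∀ i, 1 ≤ d i) {f : Fin (n + 1) → MvPolynomial (Fin (n + 1)) K}
    (hf : IsGenericSeq F d f) {N b : ℕ} (hN : ∑ i, (d i - 1) + 1 + b ≤ 2 * N) :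
    homogeneousSubmodule (Fin (n + 1)) K N ≤ formSpan f d Set.univ N ⊔
      restrictSupport K {θ : Fin (n + 1) →₀ ℕ | θ.degree = N ∧ b < θ (Fin.last n)} := by
  choose c hc hdet using fun i => exists_toeplitz_det_ne_zero K (d i) (∑ i, (d i - 1) + 1)
  let f₀ : Fin (n + 1) → MvPolynomial (Fin (n + 1)) K := fun i =>
    binaryForm (d i) (c i) (chainVar K n i) (chainVar K n (i + 1))
  have hf₀ : ∀ i, (f₀ i).IsHomogeneous (d i) := by
    intro i
    refine (homogeneousSubmodule (Fin (n + 1)) K (d i)).sum_mem fun l hl => ?_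
    refine Submodule.smul_mem _ _ ?_
    have := ((isHomogeneous_chainVar (K := K) (n := n) i).pow l).mul
      ((isHomogeneous_chainVar (K := K) (n := n) (i + 1)).pow (d i - l))
    rw [one_mul, one_mul, Nat.add_sub_cancel' (Nat.lt_succ_iff.1 (Finset.mem_range.1 hl))] at this
    exact this
  refine homogeneousSubmodule_le_formSpan_of_generic hf (f₀ := f₀) fun p hp => ?_
  have hL := lefschetzMod_chainSpace hd (I := Ideal.span (f₀ '' Set.univ)) le_rfl hc hdet
    (fun i => Ideal.subset_span ⟨i, trivial, rfl⟩) (n + 1) le_rfl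
  have h1 : Finset.univ.filter (fun j : Fin (n + 1) => j.val < n + 1) = Finset.univ :=
    Finset.filter_true_of_mem fun j _ => j.isLt
  rw [h1] at hL
  have h2 : chainVar K n (n + 1) = X (Fin.last n) := by
    rw [chainVar, dif_pos (Nat.lt_succ_self n)]
    rfl
  rw [h2] at hL
  obtain ⟨x, hx, y, hy, rfl⟩ := Submodule.mem_sup.1
    (homogeneousSubmodule_le_of_lefschetzMod hL hN hp)
  have hy' : y ∈ homogeneousSubmodule (Fin (n + 1)) K N := by
    rw [homogeneousSubmodule_eq_restrictSupport]
    exact restrictSupport_mono _ (fun θ hθ => hθ.1) hy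
  have hx' : x ∈ homogeneousSubmodule (Fin (n + 1)) K N := by
    simpa using sub_mem hp hy'
  exact Submodule.add_mem_sup ((mem_formSpan_iff hf₀ hx').2 hx) hy

end ChainVariables

/-! ### The Hilbert function of generic complete intersections -/

section Hilbert

variable {m : ℕ}

/-- The exponents of degree `t` whose first `k` entries `μ i` are less than `d i`. -/
def boxSet (d : Fin m → ℕ) (k t : ℕ) : Set (Fin m →₀ ℕ) :=
  {μ | μ.degree = t ∧ ∀ i : Fin m, i.val < k → μ i < d i}

lemma boxSet_finite (d : Fin m → ℕ) (k t : ℕ) : (boxSet d k t).Finite :=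
  (Finsupp.finite_of_degree_eq t).subset fun _ h => h.1

lemma boxSet_succ_subset (d : Fin m → ℕ) (k t : ℕ) : boxSet d (k + 1) t ⊆ boxSet d k t :=
  fun _ h => ⟨h.1, fun i hi => h.2 i (by omega)⟩

lemma boxSet_succ_of_lt (d : Fin m → ℕ) (k : Fin m) {t : ℕ} (ht : t < d k) :
    boxSet d (k.val + 1) t = boxSet d k.val t := by
  refine (boxSet_succ_subset d _ t).antisymm fun μ hμ => ⟨hμ.1, fun i hi => ?_⟩
  rcases Nat.lt_succ_iff_lt_or_eq.1 hi with h | h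
  · exact hμ.2 i h
  · rw [Fin.ext h]
    exact ((Finsupp.le_degree k μ).trans_eq hμ.1).trans_lt ht

lemma ncard_boxSet_add (d : Fin m → ℕ) (k : Fin m) (t : ℕ) :
    (boxSet d k.val (t + d k)).ncard =
      (boxSet d (k.val + 1) (t + d k)).ncard + (boxSet d k.val t).ncard := by
  have h1 : boxSet d k.val (t + d k) \ boxSet d (k.val + 1) (t + d k) =
      (fun μ => μ + Finsupp.single k (d k)) '' boxSet d k.val t := by
    ext μ
    constructor
    · rintro ⟨h, h'⟩
      have hk : d k ≤ μ k := by
        by_contra h2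
        refine h' ⟨h.1, fun i hi => ?_⟩
        rcases Nat.lt_succ_iff_lt_or_eq.1 hi with h3 | h3
        · exact h.2 i h3
        · rw [Fin.ext h3]
          exact not_le.1 h2
      have h3 : μ - Finsupp.single k (d k) + Finsupp.single k (d k) = μ :=
        tsub_add_cancel_of_le (Finsupp.single_le_iff.2 hk)
      refine ⟨_, ⟨?_, fun i hi => ?_⟩, h3⟩
      · have := congrArg Finsupp.degree h3
        rw [map_add, Finsupp.degree_single, h.1] at this
        omega
      · exact lt_of_le_of_lt (by simp) (h.2 i hi)
    · rintro ⟨μ, h, rfl⟩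
      refine ⟨⟨by simp [h.1], fun i hi => ?_⟩, fun h' => ?_⟩
      · have : k ≠ i := by
          rintro rfl
          omega
        simpa [this] using h.2 i hi
      · have := h'.2 k (Nat.lt_succ_self _)
        simp at this
  rw [← Set.ncard_sdiff_add_ncard_of_subset (boxSet_succ_subset d k.val (t + d k))
    (boxSet_finite _ _ _), h1, Set.ncard_image_of_injective _ (add_left_injective _), add_comm]

lemma ncard_boxSet_symm {d : Fin m → ℕ} {t : ℕ} (ht : t ≤ ∑ i, (d i - 1)) :
    (boxSet d m t).ncard = (boxSet d m (∑ i, (d i - 1) - t)).ncard := by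
  have key : ∀ t ≤ ∑ i, (d i - 1),
      (boxSet d m t).ncard ≤ (boxSet d m (∑ i, (d i - 1) - t)).ncard := by
    intro t ht
    refine Set.ncard_le_ncard_of_injOn
      (fun μ => Finsupp.equivFunOnFinite.symm fun i => d i - 1 - μ i) ?_ ?_ (boxSet_finite _ _ _)
    · intro μ hμ
      have h1 : μ.degree + ∑ i, (d i - 1 - μ i) = ∑ i, (d i - 1) := by
        rw [Finsupp.degree_eq_sum, ← Finset.sum_add_distrib]
        refine Finset.sum_congr rfl fun i _ => ?_
        have := hμ.2 i i.isLt
        omega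
      refine ⟨?_, fun i _ => ?_⟩
      · rw [Finsupp.degree_eq_sum]
        have := hμ.1
        simp only [Finsupp.equivFunOnFinite_symm_apply_apply]
        omega
      · have := hμ.2 i i.isLt
        simp only [Finsupp.equivFunOnFinite_symm_apply_apply]
        omega
    · intro μ hμ ν hν h
      ext i
      have h1 := congrFun (Finsupp.equivFunOnFinite.symm.injective h) i
      have h2 := hμ.2 i i.isLt
      have h3 := hν.2 i i.isLt
      omega
  refine (key t ht).antisymm ?_
  have := key (∑ i, (d i - 1) - t) (Nat.sub_le _ _)
  rwa [Nat.sub_sub_self ht] at this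

variable {K : Type*} [Field K]

lemma finrank_homogeneousSubmodule (d : Fin m → ℕ) (t : ℕ) :
    Module.finrank K (homogeneousSubmodule (Fin m) K t) = (boxSet d 0 t).ncard := by
  rw [homogeneousSubmodule_eq_restrictSupport, finrank_restrictSupport]
  congr 1
  ext μ
  simp [boxSet]

instance finiteDimensional_formSpan {r : ℕ} (f : Fin r → MvPolynomial (Fin m) K) (d : Fin r → ℕ)
    (κ : Set (Fin r)) (N : ℕ) : FiniteDimensional K (formSpan f d κ N) := by
  have : Finite {x : Fin r × (Fin m →₀ ℕ) // x.2.degree + d x.1 = N} := by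
    refine ((Set.finite_univ.prod ((Set.finite_Iic N).biUnion fun t _ =>
      Finsupp.finite_of_degree_eq (σ := Fin m) t)).subset ?_).to_subtype
    rintro ⟨i, β⟩ h
    refine ⟨trivial, Set.mem_biUnion (x := β.degree) ?_ rfl⟩
    exact Nat.le_of_add_right_le (le_of_eq h)
  refine FiniteDimensional.span_of_finite K ((Set.finite_range fun
    x : {x : Fin r × (Fin m →₀ ℕ) // x.2.degree + d x.1 = N} =>
      monomial x.1.2 1 * f x.1.1).subset ?_)
  rintro _ ⟨i, _, β, hβ, rfl⟩
  exact ⟨⟨(i, β), hβ⟩, rfl⟩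

lemma homogeneousSubmodule_le_formSpan_X_pow (d : Fin m → ℕ) (k t : ℕ) :
    homogeneousSubmodule (Fin m) K t ≤
      formSpan (fun i => X i ^ d i) d {i | i.val < k} t ⊔ restrictSupport K (boxSet d k t) := by
  rw [homogeneousSubmodule_eq_restrictSupport, restrictSupport_eq_span]
  refine Submodule.span_le.2 ?_
  rintro _ ⟨μ, hμ, rfl⟩
  by_cases h : ∀ i : Fin m, i.val < k → μ i < d i
  · refine (le_sup_right : restrictSupport K (boxSet d k t) ≤ _) ?_
    rw [restrictSupport_eq_span]
    exact Submodule.subset_span ⟨μ, ⟨hμ, h⟩, rfl⟩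
  · push Not at h
    obtain ⟨i, hi, hdi⟩ := h
    have h3 : μ - Finsupp.single i (d i) + Finsupp.single i (d i) = μ :=
      tsub_add_cancel_of_le (Finsupp.single_le_iff.2 hdi)
    refine (le_sup_left : formSpan (K := K) _ _ _ _ ≤ _)
      (Submodule.subset_span ⟨i, hi, μ - Finsupp.single i (d i), ?_, ?_⟩)
    · have := congrArg Finsupp.degree h3
      rw [map_add, Finsupp.degree_single] at this
      exact this.trans hμ
    · simp only [X_pow_eq_monomial, monomial_mul, one_mul, h3]

lemma formSpan_succ {f : Fin m → MvPolynomial (Fin m) K} {d : Fin m → ℕ} (k : Fin m) (t : ℕ) :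
    formSpan f d {i | i.val < k.val + 1} (t + d k) =
      formSpan f d {i | i.val < k.val} (t + d k) ⊔
        (homogeneousSubmodule (Fin m) K t).map (LinearMap.mulRight K (f k)) := by
  apply le_antisymm
  · refine Submodule.span_le.2 ?_
    rintro _ ⟨i, hi, β, hβ, rfl⟩
    rcases Nat.lt_succ_iff_lt_or_eq.1 hi with h | h
    · exact (le_sup_left : formSpan (K := K) _ _ _ _ ≤ _)
        (Submodule.subset_span ⟨i, h, β, hβ, rfl⟩)
    · obtain rfl := Fin.ext h
      refine (le_sup_right : _ ≤ formSpan f d {j | j.val < i.val} (t + d i) ⊔ _)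
        ⟨monomial β 1, isHomogeneous_monomial _ (by simpa using hβ), rfl⟩
  · refine sup_le (Submodule.span_mono ?_) ?_
    · rintro _ ⟨i, hi, h⟩
      exact ⟨i, Nat.lt_succ_of_lt hi, h⟩
    · rintro _ ⟨p, hp, rfl⟩
      have := mul_mem_formSpan (f := f) (d := d) (κ := {i | i.val < k.val + 1}) (N := d k)
        (p := f k) (q := p) (t := t)
        (Submodule.subset_span ⟨k, Nat.lt_succ_self _, 0, by simp, by simp⟩) hp
      rwa [add_comm (d k)] at this

lemma formSpan_succ_of_lt {f : Fin m → MvPolynomial (Fin m) K} {d : Fin m → ℕ} (k : Fin m)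
    {t : ℕ} (ht : t < d k) :
    formSpan f d {i | i.val < k.val + 1} t = formSpan f d {i | i.val < k.val} t := by
  apply le_antisymm
  · refine Submodule.span_le.2 ?_
    rintro _ ⟨i, hi, β, hβ, rfl⟩
    rcases Nat.lt_succ_iff_lt_or_eq.1 hi with h | h
    · exact Submodule.subset_span ⟨i, h, β, hβ, rfl⟩
    · obtain rfl := Fin.ext h
      omega
  · refine Submodule.span_mono ?_
    rintro _ ⟨i, hi, h⟩
    exact ⟨i, Nat.lt_succ_of_lt hi, h⟩

variable {F : Type*} [Field F] [Algebra F K]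

lemma ncard_boxSet_zero_le {f : Fin m → MvPolynomial (Fin m) K} {d : Fin m → ℕ}
    (hf : IsGenericSeq F d f) (k t : ℕ) :
    (boxSet d 0 t).ncard ≤
      Module.finrank K (formSpan f d {i | i.val < k} t) + (boxSet d k t).ncard := by
  rw [← finrank_homogeneousSubmodule (K := K), ← finrank_restrictSupport (K := K)]
  have := finiteDimensional_restrictSupport (K := K) (boxSet_finite d k t)
  exact (Submodule.finrank_mono (homogeneousSubmodule_le_formSpan_of_generic hf
    (homogeneousSubmodule_le_formSpan_X_pow d k t))).trans
      (Submodule.finrank_add_le_finrank_add_finrank _ _)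

lemma mul_mem_formSpan_of_lt {f : Fin m → MvPolynomial (Fin m) K} {d : Fin m → ℕ}
    (hf : ∀ i, (f i).IsHomogeneous (d i)) (k : Fin m) (t : ℕ) :
    ∀ p ∈ formSpan f d {i | i.val < k.val} t,
      LinearMap.mulRight K (f k) p ∈ formSpan f d {i | i.val < k.val} (t + d k) := by
  intro p hp
  rw [LinearMap.mulRight_apply, mul_comm]
  exact mul_mem_formSpan hp (hf k)

lemma finrank_formSpan {f : Fin m → MvPolynomial (Fin m) K} {d : Fin m → ℕ}
    (hf : IsGenericSeq F d f) {k : ℕ} (hk : k ≤ m) (t : ℕ) :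
    Module.finrank K (formSpan f d {i | i.val < k} t) + (boxSet d k t).ncard =
      (boxSet d 0 t).ncard := by
  refine le_antisymm ?_ (ncard_boxSet_zero_le hf k t)
  induction k generalizing t with
  | zero =>
    have : formSpan f d {i | i.val < 0} t = ⊥ := by
      refine Submodule.span_eq_bot.2 ?_
      rintro _ ⟨i, hi, _⟩
      exact absurd hi (Nat.not_lt_zero _)
    rw [this]
    simp
  | succ k ih =>
    by_cases ht : t < d ⟨k, hk⟩
    · have h1 := formSpan_succ_of_lt (f := f) (d := d) ⟨k, hk⟩ ht
      have h2 := boxSet_succ_of_lt d ⟨k, hk⟩ ht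
      simp only at h1 h2
      rw [h1, h2]
      exact ih (by omega) t
    · obtain ⟨t, rfl⟩ := Nat.exists_eq_add_of_le' (not_lt.1 ht)
      have h1 := formSpan_succ (f := f) (d := d) ⟨k, hk⟩ t
      have h2 := ncard_boxSet_add d ⟨k, hk⟩ t
      have h3 := (finrank_sup_map_add_le (LinearMap.mulRight K (f ⟨k, hk⟩))
        (formSpan_le_homogeneousSubmodule hf.1 _ t)
        (mul_mem_formSpan_of_lt hf.1 ⟨k, hk⟩ t)).1
      rw [← h1, finrank_homogeneousSubmodule d] at h3
      have h4 := ih (by omega) (t + d ⟨k, hk⟩)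
      have h5 := ncard_boxSet_zero_le hf k t
      simp only at h2 h3
      omega

/-- Generic forms form a regular sequence. -/
lemma mem_formSpan_of_mul_mem {f : Fin m → MvPolynomial (Fin m) K} {d : Fin m → ℕ}
    (hf : IsGenericSeq F d f) (k : Fin m) {t : ℕ} {p : MvPolynomial (Fin m) K}
    (hp : p.IsHomogeneous t) (h : p * f k ∈ formSpan f d {i | i.val < k.val} (t + d k)) :
    p ∈ formSpan f d {i | i.val < k.val} t := by
  refine (finrank_sup_map_add_le (LinearMap.mulRight K (f k))
    (formSpan_le_homogeneousSubmodule hf.1 _ t) (mul_mem_formSpan_of_lt hf.1 k t)).2 ?_ p hp h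
  rw [← formSpan_succ, finrank_homogeneousSubmodule d]
  have h1 := finrank_formSpan hf k.isLt (t + d k)
  have h2 := finrank_formSpan hf k.isLt.le (t + d k)
  have h3 := finrank_formSpan hf k.isLt.le t
  have h4 := ncard_boxSet_add d k t
  simp only [Nat.succ_eq_add_one] at *
  omega

end Hilbert

/-! ### Multiplication by the last variable -/

section LastVariable

variable {K : Type*} [Field K] {n : ℕ}

lemma restrictSupport_le_map_X_pow (t c : ℕ) :
    restrictSupport K {θ : Fin (n + 1) →₀ ℕ | θ.degree = t + c ∧ c ≤ θ (Fin.last n)} ≤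
      (homogeneousSubmodule (Fin (n + 1)) K t).map
        (LinearMap.mulLeft K (X (Fin.last n) ^ c)) := by
  rw [restrictSupport_eq_span]
  refine Submodule.span_le.2 ?_
  rintro _ ⟨θ, ⟨hθ, hc⟩, rfl⟩
  have h3 : Finsupp.single (Fin.last n) c + (θ - Finsupp.single (Fin.last n) c) = θ :=
    add_tsub_cancel_of_le (Finsupp.single_le_iff.2 hc)
  refine ⟨monomial (θ - Finsupp.single (Fin.last n) c) 1, isHomogeneous_monomial _ ?_, ?_⟩
  · have := congrArg Finsupp.degree h3
    rw [map_add, Finsupp.degree_single, hθ] at this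
    omega
  · rw [LinearMap.mulLeft_apply, X_pow_eq_monomial, monomial_mul, one_mul, h3]

variable {F : Type*} [Field F] [Algebra F K] [Infinite K]

/-- Multiplication by powers of the last variable is injective modulo generic forms in low
degrees. -/
lemma mem_formSpan_of_X_pow_mul_mem {d : Fin (n + 1) → ℕ} (hd : ∀ i, 1 ≤ d i)
    {f : Fin (n + 1) → MvPolynomial (Fin (n + 1)) K} (hf : IsGenericSeq F d f) {j c : ℕ}
    (hjc : 2 * j + c ≤ ∑ i, (d i - 1)) {p : MvPolynomial (Fin (n + 1)) K}
    (hp : p.IsHomogeneous j) (h : X (Fin.last n) ^ c * p ∈ formSpan f d Set.univ (j + c)) :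
    p ∈ formSpan f d Set.univ j := by
  obtain ⟨c', hc', hcc'⟩ : ∃ c', 2 * j + c' = ∑ i, (d i - 1) ∧ c ≤ c' :=
    ⟨∑ i, (d i - 1) - 2 * j, by omega, by omega⟩
  obtain ⟨s, rfl⟩ := Nat.exists_eq_add_of_le' hcc'
  have h1 : X (Fin.last n) ^ (s + c) * p ∈ formSpan f d Set.univ (j + (s + c)) := by
    have := mul_mem_formSpan h ((isHomogeneous_X K (Fin.last n)).pow s)
    rwa [one_mul, ← mul_assoc, ← pow_add, add_assoc, add_comm c] at this
  generalize s + c = c at *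
  rcases c with _ | b
  · simpa using h1
  have hspan := homogeneousSubmodule_le_formSpan_sup hd hf (N := j + (b + 1)) (b := b) (by omega)
  have huniv : {i : Fin (n + 1) | i.val < n + 1} = Set.univ := Set.eq_univ_of_forall Fin.is_lt
  have hN := finrank_formSpan hf le_rfl (j + (b + 1))
  have hj := finrank_formSpan hf le_rfl j
  rw [huniv] at hN hj
  have hsymm := ncard_boxSet_symm (d := d) (t := j) (by omega)
  rw [show ∑ i, (d i - 1) - j = j + (b + 1) by omega] at hsymm
  refine (finrank_sup_map_add_le (LinearMap.mulLeft K (X (Fin.last n) ^ (b + 1)))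
    (formSpan_le_homogeneousSubmodule hf.1 Set.univ j) (B := formSpan f d Set.univ (j + (b + 1)))
    ?_).2 ?_ p hp h1
  · intro a ha
    have := mul_mem_formSpan ha ((isHomogeneous_X K (Fin.last n)).pow (b + 1))
    rwa [one_mul] at this
  · have h2 := Submodule.finrank_mono (hspan.trans (sup_le_sup le_rfl
      (restrictSupport_le_map_X_pow (K := K) (n := n) j (b + 1))))
    rw [finrank_homogeneousSubmodule d] at h2 ⊢
    omega

/-- Multiplication by the last of the generic forms is injective in low degrees modulo the other
forms and the last variable. -/
lemma exists_sub_X_mul_mem_formSpan {d : Fin (n + 1) → ℕ} (hd : ∀ i, 1 ≤ d i)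
    {f : Fin (n + 1) → MvPolynomial (Fin (n + 1)) K} (hf : IsGenericSeq F d f) {i : ℕ}
    (hi : 2 * (d (Fin.last n) + i) ≤ ∑ i, (d i - 1) + 1) {u q : MvPolynomial (Fin (n + 1)) K}
    (hu : u.IsHomogeneous i) (hq : q.IsHomogeneous (i + d (Fin.last n) - 1))
    (h : u * f (Fin.last n) - X (Fin.last n) * q ∈
      formSpan f d {j | j.val < n} (i + d (Fin.last n))) :
    ∃ w, u - X (Fin.last n) * w ∈ formSpan f d {j | j.val < n} i := by
  have hD := hd (Fin.last n)
  set D := d (Fin.last n) with hDdef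
  have huniv : {i : Fin (n + 1) | i.val < (Fin.last n).val + 1} = Set.univ :=
    Set.eq_univ_of_forall Fin.is_lt
  have hlast : {i : Fin (n + 1) | i.val < (Fin.last n).val} = {i | i.val < n} := rfl
  have hmono : ∀ t, formSpan f d {j | j.val < n} t ≤ formSpan f d Set.univ t := fun t =>
    Submodule.span_mono fun _ ⟨i, _, hi⟩ => ⟨i, trivial, hi⟩
  have hug : u * f (Fin.last n) ∈ formSpan f d Set.univ (i + D) := by
    have := formSpan_succ (f := f) (d := d) (Fin.last n) i
    rw [huniv] at this
    rw [this]
    exact Submodule.mem_sup_right ⟨u, hu, rfl⟩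
  have hzq : X (Fin.last n) ^ 1 * q ∈ formSpan f d Set.univ (i + D - 1 + 1) := by
    rw [pow_one, Nat.sub_add_cancel (by omega)]
    have := sub_mem hug (hmono _ h)
    rwa [sub_sub_cancel] at this
  have hq' := mem_formSpan_of_X_pow_mul_mem hd hf (by omega) hq hzq
  rcases i with _ | i
  · have h1 := formSpan_succ_of_lt (f := f) (d := d) (Fin.last n) (t := 0 + D - 1) (by omega)
    rw [huniv, hlast] at h1
    rw [h1] at hq'
    have h2 := mul_mem_formSpan hq' (isHomogeneous_X K (Fin.last n))
    rw [Nat.sub_add_cancel (by omega)] at h2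
    have h3 := add_mem h h2
    rw [sub_add_cancel] at h3
    exact ⟨0, by simpa using mem_formSpan_of_mul_mem hf (Fin.last n) hu h3⟩
  · have h1 := formSpan_succ (f := f) (d := d) (Fin.last n) i
    rw [huniv, hlast] at h1
    rw [show i + 1 + D - 1 = i + D by omega, hDdef, h1] at hq'
    obtain ⟨ι, hι, _, ⟨w, hw, rfl⟩, rfl⟩ := Submodule.mem_sup.1 hq'
    refine ⟨w, mem_formSpan_of_mul_mem hf (Fin.last n) (t := i + 1) ?_ ?_⟩
    · have := (isHomogeneous_X K (Fin.last n)).mul hw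
      rw [add_comm 1 i] at this
      exact hu.sub this
    · have h2 := mul_mem_formSpan hι (isHomogeneous_X K (Fin.last n))
      rw [show i + d (Fin.last n) + 1 = i + 1 + D by omega] at h2
      have h3 := add_mem h h2
      rw [hlast, ← hDdef]
      convert h3 using 1
      rw [LinearMap.mulRight_apply]
      ring

end LastVariable

/-! ### The degree reverse lexicographic order and leading exponents -/

section Degrevlex

variable {n : ℕ}

/-- An order embedding of exponent vectors into a linear order, inducing `DrlLT`. -/
def drlKey (a : Fin n →₀ ℕ) : ℕ ×ₗ Lex (Fin n → ℕᵒᵈ) :=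
  toLex (expDeg a, toLex fun i => OrderDual.toDual (a i.rev))

lemma drlLT_iff {a b : Fin n →₀ ℕ} : DrlLT a b ↔ drlKey a < drlKey b := by
  rw [DrlLT, Prod.Lex.lt_iff]
  refine or_congr Iff.rfl (and_congr Iff.rfl ?_)
  constructor
  · rintro ⟨i, hi, h⟩
    refine ⟨i.rev, fun j hj => ?_, ?_⟩
    · exact congrArg OrderDual.toDual (h j.rev (by rwa [Fin.lt_rev_iff]))
    · change b i.rev.rev < a i.rev.rev
      rwa [Fin.rev_rev]
  · rintro ⟨i, h, hi⟩
    refine ⟨i.rev, hi, fun j hj => ?_⟩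
    have := h j.rev (Fin.rev_lt_iff.2 hj)
    have h2 : a j.rev.rev = b j.rev.rev := this
    rwa [Fin.rev_rev] at h2

lemma drlKey_injective : Function.Injective (drlKey (n := n)) := by
  intro a b h
  ext i
  have h1 := congrFun (congrArg (fun x => ofLex (ofLex x).2) h) i.rev
  have h2 : a i.rev.rev = b i.rev.rev := h1
  rwa [Fin.rev_rev] at h2

lemma DrlLT.irrefl (a : Fin n →₀ ℕ) : ¬DrlLT a a := fun h => (drlLT_iff.1 h).false

lemma drlLT_add_left_iff {a b : Fin n →₀ ℕ} (c : Fin n →₀ ℕ) :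
    DrlLT (c + a) (c + b) ↔ DrlLT a b := by
  simp only [DrlLT, expDeg_eq_degree, map_add, Finsupp.add_apply, add_lt_add_iff_left,
    add_right_inj]

lemma exists_forall_drlLT {s : Set (Fin n →₀ ℕ)} (hs : s.Finite) (hne : s.Nonempty) :
    ∃ μ ∈ s, ∀ ν ∈ s, ν ≠ μ → DrlLT ν μ := by
  obtain ⟨μ, hμ, h⟩ := Set.exists_max_image s drlKey hs hne
  exact ⟨μ, hμ, fun ν hν hne => drlLT_iff.2 ((h ν hν).lt_of_ne fun h => hne (drlKey_injective h))⟩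

variable {K : Type*} [Field K]

lemma exists_isLeadExp {p : MvPolynomial (Fin n) K} (hp : p ≠ 0) : ∃ μ, IsLeadExp p μ :=
  exists_forall_drlLT p.support.finite_toSet (by simpa using hp)

lemma IsLeadExp.ne_zero {p : MvPolynomial (Fin n) K} {μ : Fin n →₀ ℕ} (h : IsLeadExp p μ) :
    p ≠ 0 := by
  rintro rfl
  simpa using h.1

lemma IsLeadExp.monomial_mul {p : MvPolynomial (Fin n) K} {μ : Fin n →₀ ℕ} (h : IsLeadExp p μ)
    (β : Fin n →₀ ℕ) : IsLeadExp (monomial β 1 * p) (β + μ) := by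
  refine ⟨?_, fun ν hν hne => ?_⟩
  · rw [mem_support_iff, coeff_monomial_mul, one_mul]
    exact mem_support_iff.1 h.1
  · rw [mem_support_iff, coeff_monomial_mul'] at hν
    by_cases hβ : β ≤ ν
    · rw [if_pos hβ, one_mul] at hν
      have h1 : β + (ν - β) = ν := add_tsub_cancel_of_le hβ
      rw [← h1]
      refine (drlLT_add_left_iff β).2 (h.2 _ (mem_support_iff.2 hν) ?_)
      rintro rfl
      exact hne h1.symm
    · exact absurd (if_neg hβ) hν

lemma IsLeadExp.homogeneousComponent {p : MvPolynomial (Fin n) K} {μ : Fin n →₀ ℕ}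
    (h : IsLeadExp p μ) : IsLeadExp (homogeneousComponent μ.degree p) μ := by
  constructor
  · rw [mem_support_iff, coeff_homogeneousComponent, if_pos rfl]
    exact mem_support_iff.1 h.1
  · intro ν hν
    refine h.2 ν ?_
    rw [mem_support_iff, coeff_homogeneousComponent] at hν
    rw [mem_support_iff]
    intro h0
    simp [h0] at hν

/-- The leading exponents of the elements of a subspace. -/
def leadSet (W : Submodule K (MvPolynomial (Fin n) K)) : Set (Fin n →₀ ℕ) :=
  {μ | ∃ p ∈ W, IsLeadExp p μ}

/-- The exponents of degree `t` which are not leading exponents of elements of `W`. -/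
def coLeadSet (W : Submodule K (MvPolynomial (Fin n) K)) (t : ℕ) : Set (Fin n →₀ ℕ) :=
  {μ | μ.degree = t ∧ μ ∉ leadSet W}

lemma coLeadSet_finite (W : Submodule K (MvPolynomial (Fin n) K)) (t : ℕ) :
    (coLeadSet W t).Finite :=
  (Finsupp.finite_of_degree_eq t).subset fun _ h => h.1

lemma homogeneousSubmodule_le_sup_coLeadSet {W : Submodule K (MvPolynomial (Fin n) K)} {t : ℕ}
    (hW : W ≤ homogeneousSubmodule (Fin n) K t) :
    homogeneousSubmodule (Fin n) K t ≤ W ⊔ restrictSupport K (coLeadSet W t) := by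
  set U := W ⊔ restrictSupport K (coLeadSet W t) with hU
  have key : ∀ μ : Fin n →₀ ℕ, μ.degree = t → monomial μ 1 ∈ U := by
    by_contra! hbad
    obtain ⟨μ, ⟨hμ, hμU⟩, hmin⟩ := Set.exists_min_image
      {μ : Fin n →₀ ℕ | μ.degree = t ∧ monomial μ 1 ∉ U} drlKey
      ((Finsupp.finite_of_degree_eq t).subset fun _ h => h.1) hbad
    apply hμU
    by_cases h : μ ∈ leadSet W
    · obtain ⟨p, hp, hlead⟩ := h
      have hc := mem_support_iff.1 hlead.1
      have hpU : p ∈ U := Submodule.mem_sup_left hp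
      rw [p.as_sum, ← Finset.add_sum_erase _ _ hlead.1] at hpU
      have h1 : monomial μ (coeff μ p) ∈ U := by
        refine (Submodule.add_mem_iff_left U (sum_mem fun ν hν => ?_)).1 hpU
        rw [Finset.mem_erase] at hν
        by_contra h2
        have hνt : ν.degree = t := by
          by_contra h3
          exact mem_support_iff.1 hν.2 (IsHomogeneous.coeff_eq_zero (hW hp) h3)
        have h3 : monomial ν 1 ∉ U := by
          intro h4
          apply h2
          have := U.smul_mem (coeff ν p) h4
          rwa [smul_monomial, smul_eq_mul, mul_one] at this
        exact (hmin ν ⟨hνt, h3⟩).not_gt (drlLT_iff.1 (hlead.2 ν hν.2 hν.1))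
      have h2 := U.smul_mem (coeff μ p)⁻¹ h1
      rwa [smul_monomial, smul_eq_mul, inv_mul_cancel₀ hc] at h2
    · refine Submodule.mem_sup_right ?_
      rw [restrictSupport_eq_span]
      exact Submodule.subset_span ⟨μ, ⟨hμ, h⟩, rfl⟩
  rw [homogeneousSubmodule_eq_restrictSupport, restrictSupport_eq_span]
  refine Submodule.span_le.2 ?_
  rintro _ ⟨μ, hμ, rfl⟩
  exact key μ hμ

lemma finrank_add_ncard_coLeadSet {W : Submodule K (MvPolynomial (Fin n) K)} {t : ℕ}
    (hW : W ≤ homogeneousSubmodule (Fin n) K t) :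
    Module.finrank K W + (coLeadSet W t).ncard =
      Module.finrank K (homogeneousSubmodule (Fin n) K t) := by
  have h1 := finiteDimensional_restrictSupport (K := K) (coLeadSet_finite W t)
  have h2 : FiniteDimensional K W := Submodule.finiteDimensional_of_le hW
  have h3 : W ⊔ restrictSupport K (coLeadSet W t) = homogeneousSubmodule (Fin n) K t := by
    refine le_antisymm (sup_le hW ?_) (homogeneousSubmodule_le_sup_coLeadSet hW)
    rw [homogeneousSubmodule_eq_restrictSupport]
    exact restrictSupport_mono _ fun _ h => h.1
  have h4 : W ⊓ restrictSupport K (coLeadSet W t) = ⊥ := by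
    refine (Submodule.eq_bot_iff _).2 fun p hp => ?_
    by_contra h0
    obtain ⟨μ, hμ⟩ := exists_isLeadExp h0
    exact (hp.2 hμ.1).2 ⟨p, hp.1, hμ⟩
  have h5 := Submodule.finrank_sup_add_finrank_inf_eq W (restrictSupport K (coLeadSet W t))
  rw [h3, h4, finrank_bot, finrank_restrictSupport] at h5
  omega

variable {r : ℕ} {f : Fin r → MvPolynomial (Fin n) K} {d : Fin r → ℕ} {κ : Set (Fin r)}

lemma monomial_mem_initialIdeal_iff (hf : ∀ i, (f i).IsHomogeneous (d i)) {μ : Fin n →₀ ℕ} :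
    monomial μ 1 ∈ initialIdeal (Ideal.span (f '' κ)) ↔ μ ∈ leadSet (formSpan f d κ μ.degree) := by
  constructor
  · intro h
    have h1 : initialIdeal (Ideal.span (f '' κ)) = Ideal.span ((fun s => monomial s (1 : K)) ''
        {μ | ∃ p ∈ Ideal.span (f '' κ), IsLeadExp p μ}) := by
      rw [initialIdeal]
      congr 1
      ext x
      constructor
      · rintro ⟨p, hp, _, μ, hμ, rfl⟩
        exact ⟨μ, ⟨p, hp, hμ⟩, rfl⟩
      · rintro ⟨μ, ⟨p, hp, hμ⟩, rfl⟩
        exact ⟨p, hp, hμ.ne_zero, μ, hμ, rfl⟩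
    rw [h1, mem_ideal_span_monomial_image] at h
    obtain ⟨ν, ⟨p, hp, hν⟩, hle⟩ := h μ (by simp)
    have h2 : μ - ν + ν = μ := tsub_add_cancel_of_le hle
    have h3 := monomial_mul_mem_formSpan (homogeneousComponent_mem_formSpan hf hp ν.degree)
      (μ - ν) 1
    have h4 := hν.homogeneousComponent.monomial_mul (μ - ν)
    have h5 := congrArg Finsupp.degree h2
    rw [map_add, add_comm] at h5
    rw [h5] at h3
    rw [h2] at h4
    exact ⟨_, h3, h4⟩
  · rintro ⟨p, hp, hμ⟩
    exact Ideal.subset_span ⟨p, formSpan_le_span f d κ _ hp, hμ.ne_zero, μ, hμ, rfl⟩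

lemma stdMon_eq_coLeadSet (hf : ∀ i, (f i).IsHomogeneous (d i)) (t : ℕ) :
    stdMon (Ideal.span (f '' κ)) t = coLeadSet (formSpan f d κ t) t := by
  ext μ
  change expDeg μ = t ∧ _ ↔ μ.degree = t ∧ _
  rw [expDeg_eq_degree]
  refine and_congr_right fun h => not_congr ?_
  rw [monomial_mem_initialIdeal_iff hf, h]

lemma initialIdeal_eq_span (hf : ∀ i, (f i).IsHomogeneous (d i)) :
    initialIdeal (Ideal.span (f '' κ)) = Ideal.span ((fun s => monomial s (1 : K)) ''
      {μ | μ ∈ leadSet (formSpan f d κ μ.degree)}) := by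
  apply le_antisymm
  · refine Ideal.span_le.2 ?_
    rintro _ ⟨p, hp, h0, μ, hμ, rfl⟩
    have h : monomial μ 1 ∈ initialIdeal (Ideal.span (f '' κ)) :=
      Ideal.subset_span ⟨p, hp, h0, μ, hμ, rfl⟩
    have h' : μ ∈ leadSet (formSpan f d κ μ.degree) := (monomial_mem_initialIdeal_iff hf).1 h
    exact Ideal.subset_span (Set.mem_image_of_mem (fun s => monomial s (1 : K)) h')
  · refine Ideal.span_le.2 ?_
    rintro _ ⟨μ, hμ, rfl⟩
    exact (monomial_mem_initialIdeal_iff hf).2 hμ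

lemma add_mem_leadSet {μ : Fin n →₀ ℕ} {N : ℕ} (h : μ ∈ leadSet (formSpan f d κ N))
    (β : Fin n →₀ ℕ) : β + μ ∈ leadSet (formSpan f d κ (N + β.degree)) := by
  obtain ⟨p, hp, hμ⟩ := h
  exact ⟨_, monomial_mul_mem_formSpan hp β 1, hμ.monomial_mul β⟩

end Degrevlex

/-! ### Setting the last variable to zero -/

section Projection

variable {n : ℕ}

@[simp]
lemma embExp_castSucc (μ : Fin n →₀ ℕ) (j : Fin n) : embExp μ j.castSucc = μ j :=
  Finsupp.embDomain_apply_self _ _ _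

@[simp]
lemma embExp_last (μ : Fin n →₀ ℕ) : embExp μ (Fin.last n) = 0 := by
  refine Finsupp.embDomain_of_notMem_range _ _ _ ?_
  rintro ⟨j, hj⟩
  exact Fin.castSucc_ne_last j hj

lemma degree_embExp (μ : Fin n →₀ ℕ) : (embExp μ).degree = μ.degree := by
  rw [Finsupp.degree_eq_sum, Finsupp.degree_eq_sum, Fin.sum_univ_castSucc]
  simp

lemma embExp_injective : Function.Injective (embExp (n := n)) := Finsupp.embDomain_injective _

lemma zShift_last (c : ℕ) (μ : Fin n →₀ ℕ) : zShift c (embExp μ) (Fin.last n) = c := by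
  simp [zShift]

lemma degree_zShift (c : ℕ) (μ : Fin n →₀ ℕ) :
    (zShift c (embExp μ)).degree = μ.degree + c := by
  rw [zShift, map_add, Finsupp.degree_single, degree_embExp]

lemma zShift_zero (μ : Fin (n + 1) →₀ ℕ) : zShift 0 μ = μ := by
  simp [zShift]

lemma exists_eq_zShift (μ : Fin (n + 1) →₀ ℕ) :
    ∃ ν : Fin n →₀ ℕ, μ = zShift (μ (Fin.last n)) (embExp ν) := by
  refine ⟨Finsupp.equivFunOnFinite.symm fun j => μ j.castSucc, Finsupp.ext fun i => ?_⟩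
  refine Fin.lastCases ?_ (fun j => ?_) i
  · rw [zShift_last]
  · simp [zShift]

lemma drlLT_embExp_iff {a b : Fin n →₀ ℕ} : DrlLT (embExp a) (embExp b) ↔ DrlLT a b := by
  simp only [DrlLT, expDeg_eq_degree, degree_embExp]
  refine or_congr Iff.rfl (and_congr Iff.rfl ?_)
  constructor
  · rintro ⟨i, hi, h⟩
    induction i using Fin.lastCases with
    | last => simp at hi
    | cast i =>
      refine ⟨i, by simpa using hi, fun j hj => ?_⟩
      simpa using h j.castSucc (Fin.castSucc_lt_castSucc_iff.2 hj)
  · rintro ⟨i, hi, h⟩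
    refine ⟨i.castSucc, by simpa using hi, fun j hj => ?_⟩
    induction j using Fin.lastCases with
    | last => simp
    | cast j => simpa using h j (Fin.castSucc_lt_castSucc_iff.1 hj)

lemma drlLT_of_last_lt {a b : Fin (n + 1) →₀ ℕ} (h : a.degree = b.degree)
    (hlt : b (Fin.last n) < a (Fin.last n)) : DrlLT a b :=
  Or.inr ⟨h, Fin.last n, hlt, fun j hj => absurd hj (Fin.le_last j).not_gt⟩

lemma DrlLT.last_le {a b : Fin (n + 1) →₀ ℕ} (h : DrlLT a b) (hdeg : a.degree = b.degree) :
    b (Fin.last n) ≤ a (Fin.last n) := by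
  rcases h with h | ⟨_, i, hi, h⟩
  · exact absurd hdeg h.ne
  · rcases (Fin.le_last i).lt_or_eq with hlt | rfl
    · exact (h _ hlt).ge
    · exact hi.le

variable {K : Type*} [Field K]

lemma coeff_projMap (p : MvPolynomial (Fin (n + 1)) K) (ν : Fin n →₀ ℕ) :
    coeff ν (projMap K n p) = coeff (embExp ν) p := by
  induction p using MvPolynomial.induction_on' with
  | add p q hp hq => rw [map_add, coeff_add, coeff_add, hp, hq]
  | monomial μ c =>
    obtain ⟨ν', hν'⟩ := exists_eq_zShift μ
    generalize hb : μ (Fin.last n) = b at hν'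
    have h1 : projMap K n (monomial μ c) = monomial ν' c * 0 ^ b := by
      rw [projMap, aeval_monomial, Finsupp.prod_fintype _ _ (fun _ => pow_zero _),
        Fin.prod_univ_castSucc, Fin.lastCases_last, hb, ← mul_assoc]
      congr 1
      rw [monomial_eq, Finsupp.prod_fintype _ _ (fun _ => pow_zero _)]
      refine congrArg _ (Finset.prod_congr rfl fun j _ => ?_)
      rw [Fin.lastCases_castSucc, hν']
      simp [zShift]
    rw [h1, coeff_monomial]
    rcases b with _ | b
    · rw [pow_zero, mul_one, coeff_monomial, hν', zShift_zero]
      simp only [embExp_injective.eq_iff]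
    · rw [zero_pow (Nat.succ_ne_zero b), mul_zero, coeff_zero, if_neg]
      rintro rfl
      simp at hb

lemma isHomogeneous_projMap {p : MvPolynomial (Fin (n + 1)) K} {t : ℕ} (hp : p.IsHomogeneous t) :
    (projMap K n p).IsHomogeneous t := by
  refine (mem_homogeneousSubmodule _ _).1 ?_
  rw [homogeneousSubmodule_eq_restrictSupport]
  intro ν hν
  change ν.degree = t
  by_contra h
  have hν' : ν ∈ (projMap K n p).support := hν
  refine mem_support_iff.1 hν' ?_
  rw [coeff_projMap]
  exact hp.coeff_eq_zero (by rwa [degree_embExp])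

lemma projMap_monomial_embExp (ν : Fin n →₀ ℕ) (c : K) :
    projMap K n (monomial (embExp ν) c) = monomial ν c := by
  ext μ
  rw [coeff_projMap, coeff_monomial, coeff_monomial]
  simp only [embExp_injective.eq_iff]

lemma projMap_eq_zero_or (β : Fin (n + 1) →₀ ℕ) :
    projMap K n (monomial β 1) = 0 ∨
      ∃ ν : Fin n →₀ ℕ, ν.degree = β.degree ∧ projMap K n (monomial β 1) = monomial ν 1 := by
  obtain ⟨ν, hν⟩ := exists_eq_zShift β
  by_cases h : β (Fin.last n) = 0
  · rw [h, zShift_zero] at hν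
    rw [hν]
    exact Or.inr ⟨ν, (degree_embExp ν).symm, projMap_monomial_embExp ν 1⟩
  · refine Or.inl (MvPolynomial.ext _ _ fun μ => ?_)
    rw [coeff_projMap, coeff_monomial, if_neg, coeff_zero]
    rintro rfl
    exact h (embExp_last μ)

lemma map_projMap_homogeneousSubmodule (t : ℕ) :
    (homogeneousSubmodule (Fin (n + 1)) K t).map (projMap K n).toLinearMap =
      homogeneousSubmodule (Fin n) K t := by
  apply le_antisymm
  · rintro _ ⟨p, hp, rfl⟩
    exact isHomogeneous_projMap hp
  · rw [homogeneousSubmodule_eq_restrictSupport t, restrictSupport_eq_span]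
    refine Submodule.span_le.2 ?_
    rintro _ ⟨ν, hν, rfl⟩
    exact ⟨monomial (embExp ν) 1, isHomogeneous_monomial _ ((degree_embExp ν).trans hν),
      projMap_monomial_embExp ν 1⟩

lemma map_projMap_formSpan {r : ℕ} (f : Fin r → MvPolynomial (Fin (n + 1)) K) (d : Fin r → ℕ)
    (κ : Set (Fin r)) (N : ℕ) :
    (formSpan f d κ N).map (projMap K n).toLinearMap =
      formSpan (fun i => projMap K n (f i)) d κ N := by
  apply le_antisymm
  · rw [formSpan, Submodule.map_span]
    refine Submodule.span_le.2 ?_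
    rintro _ ⟨_, ⟨i, hi, β, hβ, rfl⟩, rfl⟩
    rw [AlgHom.toLinearMap_apply, map_mul]
    rcases projMap_eq_zero_or (K := K) β with h | ⟨ν, hν, h⟩
    · rw [h, zero_mul]
      exact zero_mem _
    · rw [h]
      exact Submodule.subset_span ⟨i, hi, ν, by rw [hν, hβ], rfl⟩
  · refine Submodule.span_le.2 ?_
    rintro _ ⟨i, hi, β, hβ, rfl⟩
    refine ⟨monomial (embExp β) 1 * f i, Submodule.subset_span
      ⟨i, hi, embExp β, by rw [degree_embExp, hβ], rfl⟩, ?_⟩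
    rw [AlgHom.toLinearMap_apply, map_mul, projMap_monomial_embExp]

lemma embExp_mem_leadSet_iff {W : Submodule K (MvPolynomial (Fin (n + 1)) K)} {t : ℕ}
    (hW : W ≤ homogeneousSubmodule (Fin (n + 1)) K t) {ν : Fin n →₀ ℕ} :
    embExp ν ∈ leadSet W ↔ ν ∈ leadSet (W.map (projMap K n).toLinearMap) := by
  have hsupp : ∀ p μ, μ ∈ (projMap K n p).support ↔ embExp μ ∈ p.support := by
    intro p μ
    rw [mem_support_iff, mem_support_iff, coeff_projMap]
  constructor
  · rintro ⟨p, hp, h⟩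
    refine ⟨_, ⟨p, hp, rfl⟩, (hsupp p ν).2 h.1, fun μ hμ hne => ?_⟩
    exact drlLT_embExp_iff.1 (h.2 _ ((hsupp p μ).1 hμ) (embExp_injective.ne hne))
  · rintro ⟨_, ⟨p, hp, rfl⟩, h⟩
    have hν := (hsupp p ν).1 h.1
    refine ⟨p, hp, hν, fun μ hμ hne => ?_⟩
    have hdeg : ∀ θ ∈ p.support, θ.degree = t := by
      intro θ hθ
      by_contra h1
      exact mem_support_iff.1 hθ (IsHomogeneous.coeff_eq_zero (hW hp) h1)
    by_cases h0 : μ (Fin.last n) = 0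
    · obtain ⟨ν', hν'⟩ := exists_eq_zShift μ
      rw [h0, zShift_zero] at hν'
      subst hν'
      exact drlLT_embExp_iff.2 (h.2 _ ((hsupp p ν').2 hμ) fun h' => hne (by rw [h']))
    · refine drlLT_of_last_lt ((hdeg μ hμ).trans (hdeg _ hν).symm) ?_
      rw [embExp_last]
      omega

lemma exists_eq_X_pow_mul_of_isLeadExp {p : MvPolynomial (Fin (n + 1)) K} {t c : ℕ}
    {ν : Fin n →₀ ℕ} (hp : p.IsHomogeneous t) (h : IsLeadExp p (zShift c (embExp ν))) :
    ∃ q : MvPolynomial (Fin (n + 1)) K, q.IsHomogeneous ν.degree ∧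
      p = X (Fin.last n) ^ c * q ∧ IsLeadExp q (embExp ν) := by
  have hdeg : ∀ θ ∈ p.support, θ.degree = t := by
    intro θ hθ
    by_contra h1
    exact mem_support_iff.1 hθ (hp.coeff_eq_zero h1)
  have ht : t = ν.degree + c := by rw [← hdeg _ h.1, degree_zShift]
  have hmem : p ∈ restrictSupport K
      {θ : Fin (n + 1) →₀ ℕ | θ.degree = ν.degree + c ∧ c ≤ θ (Fin.last n)} := by
    intro θ hθ
    refine ⟨(hdeg θ hθ).trans ht, ?_⟩
    by_cases hne : θ = zShift c (embExp ν)
    · rw [hne, zShift_last]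
    · have := (h.2 θ hθ hne).last_le ((hdeg θ hθ).trans (hdeg _ h.1).symm)
      rwa [zShift_last] at this
  obtain ⟨q, hq, rfl⟩ := restrictSupport_le_map_X_pow _ _ hmem
  have hsupp : ∀ θ, θ ∈ q.support ↔
      Finsupp.single (Fin.last n) c + θ ∈ (X (Fin.last n) ^ c * q).support := by
    intro θ
    rw [mem_support_iff, mem_support_iff, X_pow_eq_monomial, coeff_monomial_mul, one_mul]
  have hshift : zShift c (embExp ν) = Finsupp.single (Fin.last n) c + embExp ν := add_comm _ _
  rw [hshift, LinearMap.mulLeft_apply] at h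
  refine ⟨q, hq, rfl, (hsupp _).2 h.1, fun θ hθ hne => ?_⟩
  exact (drlLT_add_left_iff _).1 (h.2 _ ((hsupp θ).1 hθ) fun h' => hne (add_left_cancel h'))

end Projection

/-! ### Initial ideals of generic ideals with one more variable than needed -/

section InitialIdeal

variable {n : ℕ} {K : Type*} [Field K]

lemma mem_leadSet_of_le_sup {m : ℕ} {W : Submodule K (MvPolynomial (Fin m) K)} {N : ℕ}
    {Θ : Set (Fin m →₀ ℕ)} {μ : Fin m →₀ ℕ}
    (h : homogeneousSubmodule (Fin m) K N ≤ W ⊔ restrictSupport K Θ) (hμ : μ.degree = N)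
    (hΘ : ∀ θ ∈ Θ, DrlLT θ μ) : μ ∈ leadSet W := by
  obtain ⟨w, hw, q, hq, hwq⟩ := Submodule.mem_sup.1 (h (isHomogeneous_monomial (1 : K) hμ))
  have hqΘ : ∀ θ ∈ q.support, DrlLT θ μ := fun θ hθ => hΘ θ (hq hθ)
  have hcoeff : ∀ θ, coeff θ w + coeff θ q = if μ = θ then 1 else 0 := by
    intro θ
    rw [← coeff_add, hwq, coeff_monomial]
  have hqμ : coeff μ q = 0 := by
    by_contra h0
    exact (hqΘ μ (mem_support_iff.2 h0)).irrefl
  refine ⟨w, hw, mem_support_iff.2 ?_, fun θ hθ hne => hqΘ θ (mem_support_iff.2 fun h0 => ?_)⟩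
  · have := hcoeff μ
    rw [if_pos rfl, hqμ, add_zero] at this
    rw [this]
    exact one_ne_zero
  · have := hcoeff θ
    rw [if_neg hne.symm, h0, add_zero] at this
    exact mem_support_iff.1 hθ this

lemma leadSet_mono {m : ℕ} {W W' : Submodule K (MvPolynomial (Fin m) K)} (h : W ≤ W') :
    leadSet W ⊆ leadSet W' := fun _ ⟨p, hp, hμ⟩ => ⟨p, h hp, hμ⟩

lemma formSpan_mono {m r : ℕ} (f : Fin r → MvPolynomial (Fin m) K) (d : Fin r → ℕ)
    {κ κ' : Set (Fin r)} (h : κ ⊆ κ') (N : ℕ) : formSpan f d κ N ≤ formSpan f d κ' N :=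
  Submodule.span_mono fun _ ⟨i, hi, hx⟩ => ⟨i, h hi, hx⟩

lemma setOf_val_lt_succ : {i : Fin (n + 1) | i.val < (Fin.last n).val + 1} = Set.univ :=
  Set.eq_univ_of_forall fun i => i.isLt

variable {F : Type*} [Field F] [Algebra F K] {d : Fin (n + 1) → ℕ}
  {f : Fin (n + 1) → MvPolynomial (Fin (n + 1)) K}

lemma formSpan_projMap_univ (t : ℕ) :
    formSpan (fun i => projMap K n (f i)) d Set.univ (t + d (Fin.last n)) =
      formSpan (fun i => projMap K n (f i)) d {i | i.val < n} (t + d (Fin.last n)) ⊔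
        (homogeneousSubmodule (Fin n) K t).map
          (LinearMap.mulRight K (projMap K n (f (Fin.last n)))) := by
  have h := formSpan_succ (f := f) (d := d) (Fin.last n) t
  rw [setOf_val_lt_succ] at h
  rw [← map_projMap_formSpan, h, Submodule.map_sup, ← Submodule.map_comp,
    ← map_projMap_formSpan, ← map_projMap_homogeneousSubmodule (n := n), ← Submodule.map_comp]
  refine congrArg _ (congrArg (fun φ => (homogeneousSubmodule (Fin (n + 1)) K t).map φ) ?_)
  refine LinearMap.ext fun p => ?_
  simp

lemma isHomogeneous_projMap_comp (hf : ∀ i, (f i).IsHomogeneous (d i)) (i : Fin (n + 1)) :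
    (projMap K n (f i)).IsHomogeneous (d i) := isHomogeneous_projMap (hf i)

lemma embExp_mem_leadSet_of_forall_drlLT (hf : IsGenericSeq F d f) {μ : Fin n →₀ ℕ}
    (hμ : μ.degree = d (Fin.last n))
    (hmax : ∀ ν ∈ coLeadSet (formSpan (fun i => projMap K n (f i)) d {j | j.val < n}
      (d (Fin.last n))) (d (Fin.last n)), ν ≠ μ → DrlLT ν μ) :
    embExp μ ∈ leadSet (formSpan f d Set.univ (d (Fin.last n))) := by
  set Θ : Set (Fin (n + 1) →₀ ℕ) := {θ | DrlLT θ (embExp μ)}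
  refine mem_leadSet_of_le_sup (Θ := Θ) ?_ ((degree_embExp μ).trans hμ) fun _ h => h
  refine homogeneousSubmodule_le_formSpan_of_generic hf
    (f₀ := Function.update f (Fin.last n) (monomial (embExp μ) 1)) ?_
  have hW := formSpan_le_homogeneousSubmodule hf.1 {j | j.val < n} (d (Fin.last n))
  refine (homogeneousSubmodule_le_sup_coLeadSet hW).trans (sup_le ?_ ?_)
  · refine (Submodule.span_mono ?_).trans le_sup_left
    rintro _ ⟨i, hi, β, hβ, rfl⟩
    have hne : i ≠ Fin.last n := by
      rintro rfl
      exact lt_irrefl n hi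
    exact ⟨i, Set.mem_univ _, β, hβ, by rw [Function.update_of_ne hne]⟩
  · rw [restrictSupport_eq_span]
    refine Submodule.span_le.2 ?_
    rintro _ ⟨θ, hθ, rfl⟩
    by_cases hne : θ = embExp μ
    · refine Submodule.mem_sup_left (Submodule.subset_span
        ⟨Fin.last n, Set.mem_univ _, 0, by simp, ?_⟩)
      simp [hne]
    · refine Submodule.mem_sup_right ?_
      rw [restrictSupport_eq_span]
      refine Submodule.subset_span ⟨θ, ?_, rfl⟩
      by_cases h0 : θ (Fin.last n) = 0
      · obtain ⟨ν, hν⟩ := exists_eq_zShift θ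
        rw [h0, zShift_zero] at hν
        subst hν
        refine drlLT_embExp_iff.2 (hmax ν ⟨(degree_embExp ν).symm.trans hθ.1, fun h => ?_⟩
          fun h => hne (by rw [h]))
        rw [← map_projMap_formSpan, ← embExp_mem_leadSet_iff hW] at h
        exact hθ.2 h
      · refine drlLT_of_last_lt (hθ.1.trans ((degree_embExp μ).trans hμ).symm) ?_
        rw [embExp_last]
        omega

lemma embExp_mem_leadSet_formSpan_iff (hf : ∀ i, (f i).IsHomogeneous (d i)) {κ : Set (Fin (n + 1))}
    {t : ℕ} {ν : Fin n →₀ ℕ} : embExp ν ∈ leadSet (formSpan f d κ t) ↔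
      ν ∈ leadSet (formSpan (fun i => projMap K n (f i)) d κ t) := by
  rw [← map_projMap_formSpan,
    embExp_mem_leadSet_iff (formSpan_le_homogeneousSubmodule hf κ t)]

lemma coLeadSet_formSpan_zero {m r : ℕ} {f : Fin r → MvPolynomial (Fin m) K} {d : Fin r → ℕ}
    (hd : ∀ i, 1 ≤ d i) (κ : Set (Fin r)) : coLeadSet (formSpan f d κ 0) 0 = {0} := by
  have hbot : formSpan f d κ 0 = ⊥ := by
    refine Submodule.span_eq_bot.2 ?_
    rintro _ ⟨i, _, β, hβ, _⟩
    have := hd i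
    omega
  ext μ
  rw [Set.mem_singleton_iff, ← Finsupp.degree_eq_zero_iff]
  refine ⟨fun h => h.1, fun h => ⟨h, ?_⟩⟩
  rintro ⟨p, hp, hμ⟩
  rw [hbot] at hp
  exact hμ.ne_zero hp

/-- The exponents `ν` of degree `t` standard for the projection of the ideal of the first `n`
forms, but leading for the projection of the ideal of all the forms. -/
def newLeadSet (f : Fin (n + 1) → MvPolynomial (Fin (n + 1)) K) (d : Fin (n + 1) → ℕ) (t : ℕ) :
    Set (Fin n →₀ ℕ) :=
  coLeadSet (formSpan (fun i => projMap K n (f i)) d {j | j.val < n} t) t \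
    coLeadSet (formSpan (fun i => projMap K n (f i)) d Set.univ t) t

lemma embExp_mem_leadSet_of_mem_newLeadSet (hf : ∀ i, (f i).IsHomogeneous (d i)) {t : ℕ}
    {ν : Fin n →₀ ℕ} (h : ν ∈ newLeadSet f d t) :
    embExp ν ∈ leadSet (formSpan f d Set.univ t) := by
  rw [embExp_mem_leadSet_formSpan_iff hf]
  by_contra h1
  exact h.2 ⟨h.1.1, h1⟩

lemma mem_newLeadSet (hf : ∀ i, (f i).IsHomogeneous (d i)) {t : ℕ} {ν : Fin n →₀ ℕ}
    (hν : ν ∈ coLeadSet (formSpan (fun i => projMap K n (f i)) d {j | j.val < n} t) t)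
    (h : embExp ν ∈ leadSet (formSpan f d Set.univ t)) : ν ∈ newLeadSet f d t :=
  ⟨hν, fun h1 => h1.2 ((embExp_mem_leadSet_formSpan_iff hf).1 h)⟩

variable [Infinite K]

lemma mem_formSpan_projMap_of_mul_mem (hd : ∀ i, 1 ≤ d i) (hf : IsGenericSeq F d f) {i : ℕ}
    (hi : 2 * (d (Fin.last n) + i) ≤ ∑ i, (d i - 1) + 1) {v : MvPolynomial (Fin n) K}
    (hv : v.IsHomogeneous i) (h : v * projMap K n (f (Fin.last n)) ∈
      formSpan (fun i => projMap K n (f i)) d {j | j.val < n} (i + d (Fin.last n))) :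
    v ∈ formSpan (fun i => projMap K n (f i)) d {j | j.val < n} i := by
  have hv' : v ∈ (homogeneousSubmodule (Fin (n + 1)) K i).map (projMap K n).toLinearMap := by
    rw [map_projMap_homogeneousSubmodule]
    exact hv
  obtain ⟨u, hu, rfl⟩ := hv'
  rw [← map_projMap_formSpan] at h ⊢
  obtain ⟨ι, hι, hιu⟩ := h
  simp only [AlgHom.toLinearMap_apply] at hιu ⊢
  have hD := hd (Fin.last n)
  have hιh := formSpan_le_homogeneousSubmodule hf.1 _ _ hι
  have hdiff : (u * f (Fin.last n) - ι).IsHomogeneous (i + d (Fin.last n)) :=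
    (homogeneousSubmodule (Fin (n + 1)) K _).sub_mem (IsHomogeneous.mul hu (hf.1 _)) hιh
  have hmem : u * f (Fin.last n) - ι ∈ restrictSupport K {θ : Fin (n + 1) →₀ ℕ |
      θ.degree = i + d (Fin.last n) - 1 + 1 ∧ 1 ≤ θ (Fin.last n)} := by
    intro θ hθ
    have hθ' : coeff θ (u * f (Fin.last n) - ι) ≠ 0 := mem_support_iff.1 hθ
    have hdeg : θ.degree = i + d (Fin.last n) := by
      by_contra h1
      exact hθ' (hdiff.coeff_eq_zero h1)
    refine ⟨by omega, Nat.one_le_iff_ne_zero.2 fun h0 => hθ' ?_⟩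
    obtain ⟨ν, hν⟩ := exists_eq_zShift θ
    rw [h0, zShift_zero] at hν
    rw [hν, ← coeff_projMap, map_sub, map_mul, hιu, sub_self, coeff_zero]
  obtain ⟨q, hq, hqe⟩ := restrictSupport_le_map_X_pow _ _ hmem
  rw [pow_one, LinearMap.mulLeft_apply] at hqe
  obtain ⟨w, hw⟩ := exists_sub_X_mul_mem_formSpan hd hf hi hu hq
    (by rwa [hqe, sub_sub_cancel])
  refine ⟨_, hw, ?_⟩
  rw [AlgHom.toLinearMap_apply, map_sub, map_mul]
  simp [projMap]

lemma finrank_formSpan_projMap (hd : ∀ i, 1 ≤ d i) (hf : IsGenericSeq F d f) {i : ℕ}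
    (hi : 2 * (d (Fin.last n) + i) ≤ ∑ i, (d i - 1) + 1) :
    Module.finrank K
        (formSpan (fun i => projMap K n (f i)) d Set.univ (i + d (Fin.last n))) +
      Module.finrank K (formSpan (fun i => projMap K n (f i)) d {j | j.val < n} i) =
    Module.finrank K
        (formSpan (fun i => projMap K n (f i)) d {j | j.val < n} (i + d (Fin.last n))) +
      Module.finrank K (homogeneousSubmodule (Fin n) K i) := by
  have hker : formSpan (fun i => projMap K n (f i)) d {j | j.val < n} i =
      homogeneousSubmodule (Fin n) K i ⊓
        (formSpan (fun i => projMap K n (f i)) d {j | j.val < n} (i + d (Fin.last n))).comap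
          (LinearMap.mulRight K (projMap K n (f (Fin.last n)))) := by
    refine le_antisymm (fun v hv => ⟨?_, ?_⟩) fun v hv =>
      mem_formSpan_projMap_of_mul_mem hd hf hi hv.1 hv.2
    · exact formSpan_le_homogeneousSubmodule (isHomogeneous_projMap_comp hf.1) _ _ hv
    · change v * projMap K n (f (Fin.last n)) ∈
        formSpan (fun i => projMap K n (f i)) d {j | j.val < n} (i + d (Fin.last n))
      rw [mul_comm]
      exact mul_mem_formSpan hv (isHomogeneous_projMap_comp hf.1 _)
  rw [formSpan_projMap_univ, hker]
  exact finrank_sup_map_add _ _ _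

lemma ncard_newLeadSet (hd : ∀ i, 1 ≤ d i) (hf : IsGenericSeq F d f) {i : ℕ}
    (hi : 2 * (d (Fin.last n) + i) ≤ ∑ i, (d i - 1) + 1) :
    (newLeadSet f d (i + d (Fin.last n))).ncard =
      (coLeadSet (formSpan (fun i => projMap K n (f i)) d {j | j.val < n} i) i).ncard := by
  have h1 := finrank_formSpan_projMap hd hf hi
  have hh := formSpan_le_homogeneousSubmodule (isHomogeneous_projMap_comp hf.1)
  have h2 := finrank_add_ncard_coLeadSet (hh Set.univ (i + d (Fin.last n)))
  have h3 := finrank_add_ncard_coLeadSet (hh {j | j.val < n} (i + d (Fin.last n)))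
  have h4 := finrank_add_ncard_coLeadSet (hh {j | j.val < n} i)
  have hsub : coLeadSet (formSpan (fun i => projMap K n (f i)) d Set.univ
      (i + d (Fin.last n))) (i + d (Fin.last n)) ⊆
      coLeadSet (formSpan (fun i => projMap K n (f i)) d {j | j.val < n}
      (i + d (Fin.last n))) (i + d (Fin.last n)) :=
    fun μ hμ => ⟨hμ.1, fun h => hμ.2 (leadSet_mono (formSpan_mono _ _ (Set.subset_univ _) _) h)⟩
  have h5 := Set.ncard_sdiff_add_ncard_of_subset hsub (coLeadSet_finite _ _)
  rw [newLeadSet]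
  omega

lemma mem_leadSet_of_two_mul_degree (hd : ∀ i, 1 ≤ d i) (hf : IsGenericSeq F d f)
    {μ : Fin (n + 1) →₀ ℕ} (h : ∑ i, (d i - 1) + 1 + μ (Fin.last n) ≤ 2 * μ.degree) :
    μ ∈ leadSet (formSpan f d Set.univ μ.degree) :=
  mem_leadSet_of_le_sup (homogeneousSubmodule_le_formSpan_sup hd hf h) rfl
    fun _ hθ => drlLT_of_last_lt hθ.1 hθ.2
lemma exists_newLeadSet_eq_singleton (hd : ∀ i, 1 ≤ d i) (hf : IsGenericSeq F d f)
    (hD : 2 * d (Fin.last n) ≤ ∑ i, (d i - 1) + 1) :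
    ∃ μ, newLeadSet f d (d (Fin.last n)) = {μ} ∧
      ∀ ν ∈ coLeadSet (formSpan (fun i => projMap K n (f i)) d {j | j.val < n}
        (d (Fin.last n))) (d (Fin.last n)), ν ≠ μ → DrlLT ν μ := by
  have h1 := ncard_newLeadSet hd hf (i := 0) (by omega)
  rw [coLeadSet_formSpan_zero hd, Set.ncard_singleton, zero_add] at h1
  obtain ⟨μ', hμ'⟩ := Set.ncard_eq_one.1 h1
  have hmem : μ' ∈ newLeadSet f d (d (Fin.last n)) := by
    rw [hμ']
    exact Set.mem_singleton _
  obtain ⟨μ, hμ, hmax⟩ := exists_forall_drlLT (coLeadSet_finite _ _) ⟨μ', hmem.1⟩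
  have h2 := mem_newLeadSet hf.1 hμ (embExp_mem_leadSet_of_forall_drlLT hf hμ.1 hmax)
  rw [hμ', Set.mem_singleton_iff] at h2
  exact ⟨μ, by rw [hμ', h2], hmax⟩

lemma exists_mem_newLeadSet_le (hd : ∀ i, 1 ≤ d i) (hf : IsGenericSeq F d f) {s t : ℕ}
    (hs : ∑ i, (d i - 1) + 1 ≤ 2 * s) (hst : s ≤ t) {ν : Fin n →₀ ℕ}
    (hν : ν ∈ coLeadSet (formSpan (fun i => projMap K n (f i)) d {j | j.val < n} t) t) :
    ∃ ν' ∈ newLeadSet f d s, ν' ≤ ν := by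
  obtain ⟨ν', hle, rfl⟩ := Finsupp.exists_le_degree_eq ν s (by rwa [hν.1])
  refine ⟨ν', mem_newLeadSet hf.1 ⟨rfl, fun h => hν.2 ?_⟩ ?_, hle⟩
  · have h1 := tsub_add_cancel_of_le hle
    have h2 := congrArg Finsupp.degree h1
    rw [map_add, add_comm, hν.1] at h2
    have h3 := add_mem_leadSet h (ν - ν')
    rwa [h1, h2] at h3
  · have h := mem_leadSet_of_two_mul_degree hd hf (μ := embExp ν')
      (by rwa [embExp_last, degree_embExp, add_zero])
    rwa [degree_embExp] at h

lemma mem_leadSet_of_zShift_mem_leadSet (hd : ∀ i, 1 ≤ d i) (hf : IsGenericSeq F d f) {c : ℕ}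
    {ν : Fin n →₀ ℕ} (hc : 2 * ν.degree + c ≤ ∑ i, (d i - 1))
    (h : zShift c (embExp ν) ∈ leadSet (formSpan f d Set.univ (ν.degree + c))) :
    embExp ν ∈ leadSet (formSpan f d Set.univ ν.degree) := by
  obtain ⟨p, hp, hlead⟩ := h
  obtain ⟨q, hq, rfl, hqlead⟩ := exists_eq_X_pow_mul_of_isLeadExp
    (formSpan_le_homogeneousSubmodule hf.1 _ _ hp) hlead
  exact ⟨q, mem_formSpan_of_X_pow_mul_mem hd hf hc hq hp, hqlead⟩

lemma embExp_mono {ν' ν : Fin n →₀ ℕ} (h : ν' ≤ ν) (c : ℕ) : embExp ν' ≤ zShift c (embExp ν) := by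
  intro i
  induction i using Fin.lastCases with
  | last => simp
  | cast i => simpa [zShift] using h i

lemma zShift_mono {c' c : ℕ} (h : c' ≤ c) (μ : Fin (n + 1) →₀ ℕ) : zShift c' μ ≤ zShift c μ :=
  add_le_add_right (Finsupp.single_mono h) μ

/-- Monomials generating the initial ideal of `n + 1` generic forms over that of the first `n`
of them. -/
lemma initialIdeal_eq_sup (hd : ∀ i, 1 ≤ d i) (hf : IsGenericSeq F d f) {D δ s : ℕ}
    (hD : D = d (Fin.last n)) (hδ : ∑ i, (d i - 1) + 1 = δ + D) (hs : δ = D + 2 * s)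
    (hs1 : 1 ≤ s) {B : ℕ → Set (Fin n →₀ ℕ)} (hB : ∀ t, B t =
      coLeadSet (formSpan (fun i => projMap K n (f i)) d {j | j.val < n} t) t)
    {μ0 : Fin n →₀ ℕ} (hμ0 : newLeadSet f d D = {μ0}) :
    initialIdeal (Ideal.span (f '' Set.univ)) =
      initialIdeal (Ideal.span (f '' {j | j.val < n})) ⊔
        Ideal.span ((fun ν => monomial ν (1 : K)) ''
          ({embExp μ0} ∪ (⋃ i ∈ Finset.Icc 1 s, embExp '' newLeadSet f d (i + D)) ∪
            (⋃ k ∈ Finset.Icc 1 s, zShift (2 * k) '' (embExp '' B (D + s - k))) ∪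
            (⋃ j ∈ Finset.Icc 1 D, zShift (δ - D + 2 * j) '' (embExp '' B (D - j))))) := by
  set G : Set (Fin (n + 1) →₀ ℕ) := {embExp μ0} ∪
    (⋃ i ∈ Finset.Icc 1 s, embExp '' newLeadSet f d (i + D)) ∪
    (⋃ k ∈ Finset.Icc 1 s, zShift (2 * k) '' (embExp '' B (D + s - k))) ∪
    (⋃ j ∈ Finset.Icc 1 D, zShift (δ - D + 2 * j) '' (embExp '' B (D - j))) with hG
  apply le_antisymm
  · set M := initialIdeal (Ideal.span (f '' {j | j.val < n})) ⊔
      Ideal.span ((fun ν => monomial ν (1 : K)) '' G) with hM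
    have hdvd : ∀ {θ μ : Fin (n + 1) →₀ ℕ}, θ ≤ μ → monomial θ (1 : K) ∈ M →
        monomial μ (1 : K) ∈ M := fun h hθ => M.mem_of_dvd
          ((monomial_dvd_monomial (R := K)).2 ⟨Or.inr h, dvd_rfl⟩) hθ
    have hgen : ∀ {θ μ : Fin (n + 1) →₀ ℕ}, θ ∈ G → θ ≤ μ → monomial μ (1 : K) ∈ M :=
      fun hθ h => hdvd h (Ideal.mem_sup_right (Ideal.subset_span
        (Set.mem_image_of_mem (fun ν => monomial ν (1 : K)) hθ)))
    have hnew : ∀ {i : ℕ} {ν : Fin n →₀ ℕ}, i ≤ s → ν ∈ newLeadSet f d (i + D) →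
        embExp ν ∈ G := by
      intro i ν hi hν
      rcases Nat.eq_zero_or_pos i with rfl | hi0
      · rw [zero_add, hμ0, Set.mem_singleton_iff] at hν
        exact Or.inl (Or.inl (Or.inl (by rw [hν, Set.mem_singleton_iff])))
      · exact Or.inl (Or.inl (Or.inr (Set.mem_biUnion (Finset.mem_Icc.2 ⟨hi0, hi⟩) ⟨ν, hν, rfl⟩)))
    rw [initialIdeal_eq_span hf.1]
    refine Ideal.span_le.2 ?_
    rintro _ ⟨μ, hμ, rfl⟩
    change monomial μ (1 : K) ∈ M
    obtain ⟨ν, hν⟩ := exists_eq_zShift μ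
    generalize μ (Fin.last n) = c at hν
    subst hν
    rw [Set.mem_ofPred_eq, degree_zShift] at hμ
    by_cases hlow : ν ∈ leadSet (formSpan (fun i => projMap K n (f i)) d {j | j.val < n} ν.degree)
    · refine hdvd (embExp_mono le_rfl c) (Ideal.mem_sup_left ?_)
      rw [monomial_mem_initialIdeal_iff hf.1, embExp_mem_leadSet_formSpan_iff hf.1, degree_embExp]
      exact hlow
    have hνB : ν ∈ coLeadSet (formSpan (fun i => projMap K n (f i)) d {j | j.val < n} ν.degree)
      ν.degree := ⟨rfl, hlow⟩
    by_cases hbig : s + D ≤ ν.degree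
    · obtain ⟨ν', hν', hle⟩ := exists_mem_newLeadSet_le hd hf (by omega) hbig hνB
      exact hgen (hnew le_rfl hν') (embExp_mono hle c)
    by_cases hc : 2 * ν.degree + c ≤ ∑ i, (d i - 1)
    · have hlead := mem_leadSet_of_zShift_mem_leadSet hd hf hc hμ
      by_cases hνD : ν.degree < D
      · have h := formSpan_succ_of_lt (f := f) (d := d) (Fin.last n) (hD ▸ hνD)
        rw [setOf_val_lt_succ] at h
        rw [h] at hlead
        exact absurd ((embExp_mem_leadSet_formSpan_iff hf.1).1 hlead) hlow
      · obtain ⟨i, hi⟩ := Nat.exists_eq_add_of_le' (not_lt.1 hνD)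
        have h := mem_newLeadSet hf.1 hνB hlead
        rw [hi] at h
        exact hgen (hnew (by omega) h) (embExp_mono le_rfl c)
    · rw [← hB] at hνB
      by_cases hνD : ν.degree < D
      · refine hgen (θ := zShift (δ - D + 2 * (D - ν.degree)) (embExp ν)) (Or.inr ?_)
          (zShift_mono (by omega) _)
        refine Set.mem_biUnion (Finset.mem_Icc.2 ⟨by omega, by omega⟩) ⟨_, ⟨ν, ?_, rfl⟩, rfl⟩
        rwa [Nat.sub_sub_self hνD.le]
      · refine hgen (θ := zShift (2 * (D + s - ν.degree)) (embExp ν)) (Or.inl (Or.inr ?_))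
          (zShift_mono (by omega) _)
        refine Set.mem_biUnion (Finset.mem_Icc.2 ⟨by omega, by omega⟩) ⟨_, ⟨ν, ?_, rfl⟩, rfl⟩
        rwa [Nat.sub_sub_self (by omega)]
  · have hz : ∀ {c : ℕ} {ν : Fin n →₀ ℕ}, δ + D ≤ 2 * ν.degree + c →
        zShift c (embExp ν) ∈ leadSet (formSpan f d Set.univ (zShift c (embExp ν)).degree) := by
      intro c ν h
      refine mem_leadSet_of_two_mul_degree hd hf ?_
      rw [zShift_last, degree_zShift]
      omega
    have hdeg : ∀ {t : ℕ} {ν : Fin n →₀ ℕ}, ν ∈ B t → ν.degree = t := by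
      intro t ν h
      rw [hB] at h
      exact h.1
    have hnew : ∀ {t : ℕ} {ν : Fin n →₀ ℕ}, ν ∈ newLeadSet f d t →
        embExp ν ∈ leadSet (formSpan f d Set.univ (embExp ν).degree) := by
      intro t ν h
      rw [degree_embExp, show ν.degree = t from h.1.1]
      exact embExp_mem_leadSet_of_mem_newLeadSet hf.1 h
    refine sup_le ?_ (Ideal.span_le.2 ?_)
    · refine Ideal.span_mono ?_
      rintro _ ⟨p, hp, h⟩
      exact ⟨p, Ideal.span_mono (Set.image_mono (Set.subset_univ _)) hp, h⟩
    · rintro _ ⟨θ, hθ, rfl⟩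
      refine (monomial_mem_initialIdeal_iff hf.1).2 ?_
      rcases hθ with ((rfl | hθ) | hθ) | hθ
      · exact hnew (hμ0 ▸ Set.mem_singleton μ0)
      · obtain ⟨i, hi, ν, hν, rfl⟩ := Set.mem_iUnion₂.1 hθ
        exact hnew hν
      · obtain ⟨k, hk, _, ⟨ν, hν, rfl⟩, rfl⟩ := Set.mem_iUnion₂.1 hθ
        have := hdeg hν
        rw [Finset.mem_Icc] at hk
        exact hz (by omega)
      · obtain ⟨j, hj, _, ⟨ν, hν, rfl⟩, rfl⟩ := Set.mem_iUnion₂.1 hθ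
        have := hdeg hν
        rw [Finset.mem_Icc] at hj
        exact hz (by omega)

end InitialIdeal

/-- description of `in(I,g)` when `d < δ` and `δ − d` is even. -/
theorem stmt6 {F K : Type*} [Field F] [Field K] [Algebra F K] [Infinite K]
    {n : ℕ} (hn : 0 < n) (d : Fin n → ℕ) (hd : ∀ i, 1 ≤ d i) (hmono : Monotone d)
    (D : ℕ) (hdD : ∀ i, d i ≤ D)
    (f : Fin n → MvPolynomial (Fin (n + 1)) K) (g : MvPolynomial (Fin (n + 1)) K)
    (hfg : IsGenericSeq F (Fin.snoc d D) (Fin.snoc f g))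
    (I Ig : Ideal (MvPolynomial (Fin (n + 1)) K))
    (hI : I = Ideal.span (Set.range f)) (hIg : Ig = Ideal.span (Set.range (Fin.snoc f g)))
    (J : Ideal (MvPolynomial (Fin n) K)) (hJ : J = I.map (projMap K n))
    (δ istar : ℕ) (hδ : δ = (∑ j, d j) - n) (hDδ : D < δ) (histar : istar = (δ - D) / 2)
    (heven : Even (δ - D)) :
    ∃ T : ℕ → Set (Fin n →₀ ℕ),
      (∀ i ∈ Finset.Icc 1 istar,
        T i ⊆ stdMon J (D + i) ∧ (T i).ncard = (stdMon J i).ncard) ∧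
      ∃ μ0 ∈ stdMon J D, (∀ ν ∈ stdMon J D, ν ≠ μ0 → DrlLT ν μ0) ∧
        initialIdeal Ig =
          initialIdeal I ⊔ Ideal.span ((fun ν => monomial ν (1 : K)) ''
            ({embExp μ0} ∪ (⋃ i ∈ Finset.Icc 1 istar, embExp '' T i) ∪
              (⋃ k ∈ Finset.Icc 1 istar,
                zShift (2 * k) '' (embExp '' stdMon J (D + istar - k))) ∪
              (⋃ j ∈ Finset.Icc 1 D,
                zShift (δ - D + 2 * j) '' (embExp '' stdMon J (D - j))))) := by
  have hlast : Fin.snoc (α := fun _ => ℕ) d D (Fin.last n) = D := Fin.snoc_last _ _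
  have hd' : ∀ i, 1 ≤ (Fin.snoc d D : Fin (n + 1) → ℕ) i := by
    intro i
    induction i using Fin.lastCases with
    | last => rw [Fin.snoc_last]; exact (hd ⟨0, hn⟩).trans (hdD _)
    | cast i => rw [Fin.snoc_castSucc]; exact hd i
  have hD1 : 1 ≤ D := hlast ▸ hd' (Fin.last n)
  have hsum : ∑ i, ((Fin.snoc d D : Fin (n + 1) → ℕ) i - 1) + 1 = δ + D := by
    have h1 : ∑ i, (d i - 1) + n = ∑ i, d i := by
      have h2 : ∑ i, (d i - 1 + 1) = ∑ i, d i :=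
        Finset.sum_congr rfl fun i _ => Nat.sub_add_cancel (hd i)
      simpa [Finset.sum_add_distrib] using h2
    rw [Fin.sum_univ_castSucc, hlast]
    simp only [Fin.snoc_castSucc]
    omega
  have hδs : δ = D + 2 * istar := by
    obtain ⟨k, hk⟩ := heven
    omega
  have hIf : I = Ideal.span ((Fin.snoc f g : Fin (n + 1) → _) '' {i | i.val < n}) := by
    rw [hI]
    congr 1
    ext p
    constructor
    · rintro ⟨i, rfl⟩
      exact ⟨i.castSucc, i.isLt, Fin.snoc_castSucc _ _ _⟩
    · rintro ⟨i, hi, rfl⟩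
      exact ⟨⟨i, hi⟩, (Fin.snoc_castSucc (α := fun _ => MvPolynomial (Fin (n + 1)) K) g f _).symm⟩
  rw [← Set.image_univ] at hIg
  have hB : ∀ t, stdMon J t = coLeadSet (formSpan
      (fun i => projMap K n ((Fin.snoc f g : Fin (n + 1) → _) i)) (Fin.snoc d D)
      {j | j.val < n} t) t := by
    intro t
    rw [hJ, hIf, Ideal.map_span, Set.image_image]
    exact stdMon_eq_coLeadSet (isHomogeneous_projMap_comp hfg.1) t
  have hcard : ∀ i, 2 * (D + i) ≤ δ + D →
      (newLeadSet (Fin.snoc f g) (Fin.snoc d D) (i + D)).ncard = (stdMon J i).ncard := by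
    intro i hi
    have h := ncard_newLeadSet hd' hfg (i := i) (by rwa [hlast, hsum])
    rwa [hlast, ← hB] at h
  obtain ⟨μ0, hμ0, hmax⟩ := exists_newLeadSet_eq_singleton hd' hfg (by rw [hlast, hsum]; omega)
  rw [hlast] at hμ0 hmax
  rw [← hB] at hmax
  have hsub : ∀ t, newLeadSet (Fin.snoc f g) (Fin.snoc d D) t ⊆ stdMon J t := by
    intro t ν hν
    rw [hB]
    exact hν.1
  refine ⟨fun i => newLeadSet (Fin.snoc f g) (Fin.snoc d D) (i + D), fun i hi => ⟨?_, ?_⟩,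
    μ0, hsub D (hμ0 ▸ Set.mem_singleton μ0), hmax, ?_⟩
  · rw [add_comm D i]
    exact hsub (i + D)
  · rw [Finset.mem_Icc] at hi
    exact hcard i (by omega)
  · rw [hIg, hIf]
    exact initialIdeal_eq_sup hd' hfg hlast.symm hsum hδs (by omega) hB hμ0
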